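/- The following are equivalent: (1) ω₁ is a limit cardinal in L; (2) WRP^L(ω₁); (3) SRP^L(ω₁). -/

import Mathlib

/-!
Common set-theoretic infrastructure for formalizing the paper
"The strong reflecting property and Harrington's Principle".

We work over Mathlib's `ZFSet.{0}` (a model of ZFC).  First-order satisfaction
for the language of set theory (with two auxiliary unary predicates) is
defined directly; Gödel's constructible hierarchy `L` (and its relativized
versions `L[A]`), hereditarily-small sets `H_κ`, transitive collapses,
clubs, elementary submodels, admissible ordinals, and the various
reflecting properties are all defined from first principles.
-/

noncomputable section
attribute [local instance] Classical.propDecidable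
namespace SRPPaper

open ZFSet

/-- Image of a `ZFSet.{0}` under an arbitrary (classically definable) function. -/
def img (f : ZFSet.{0} → ZFSet.{0}) : ZFSet.{0} → ZFSet.{0} :=
  @ZFSet.image f (Classical.allZFSetDefinable _)

/-! ### First-order formulas and satisfaction -/

/-- First-order formulas in the language `{∈, =, A, B}` where `A`, `B` are
unary predicate symbols; variables are de Bruijn-style indices in `Fin n`. -/
inductive Fml : ℕ → Type
  | mem {n} (i j : Fin n) : Fml n
  | eq {n} (i j : Fin n) : Fml n
  | inA {n} (i : Fin n) : Fml n
  | inB {n} (i : Fin n) : Fml n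
  | not {n} : Fml n → Fml n
  | and {n} : Fml n → Fml n → Fml n
  | ex {n} : Fml (n + 1) → Fml n

/-- Satisfaction over the structure `(S, ∈, A, B)`; quantifiers range over `S`,
the new variable of `ex` gets index `0`. -/
def SatAB (S A B : Set ZFSet.{0}) : ∀ {n}, Fml n → (Fin n → ZFSet.{0}) → Prop
  | _, .mem i j, v => v i ∈ v j
  | _, .eq i j, v => v i = v j
  | _, .inA i, v => v i ∈ A
  | _, .inB i, v => v i ∈ B
  | _, .not φ, v => ¬ SatAB S A B φ v
  | _, .and φ ψ, v => SatAB S A B φ v ∧ SatAB S A B ψ v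
  | _, .ex φ, v => ∃ x ∈ S, SatAB S A B φ (Fin.cons x v)

/-- Pure `∈`-satisfaction over the structure `(S, ∈)`. -/
def Sat (S : Set ZFSet.{0}) {n} (φ : Fml n) (v : Fin n → ZFSet.{0}) : Prop :=
  SatAB S ∅ ∅ φ v

/-- Δ₀ (bounded) formulas. -/
inductive IsDelta0 : ∀ {n}, Fml n → Prop
  | mem {n} (i j : Fin n) : IsDelta0 (.mem i j)
  | eq {n} (i j : Fin n) : IsDelta0 (.eq i j)
  | inA {n} (i : Fin n) : IsDelta0 (.inA i)
  | inB {n} (i : Fin n) : IsDelta0 (.inB i)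
  | not {n} {φ : Fml n} : IsDelta0 φ → IsDelta0 (.not φ)
  | and {n} {φ ψ : Fml n} : IsDelta0 φ → IsDelta0 ψ → IsDelta0 (.and φ ψ)
  | bex {n} (j : Fin (n + 1)) {φ : Fml (n + 1)} : j ≠ 0 → IsDelta0 φ →
      IsDelta0 (.ex (.and (.mem 0 j) φ))

/-- A Gödel code for formulas. -/
def codeF : ∀ {n}, Fml n → ℕ
  | _, .mem i j => Nat.pair 0 (Nat.pair i.val j.val)
  | _, .eq i j => Nat.pair 1 (Nat.pair i.val j.val)
  | _, .inA i => Nat.pair 2 i.val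
  | _, .inB i => Nat.pair 3 i.val
  | _, .not φ => Nat.pair 4 (codeF φ)
  | _, .and φ ψ => Nat.pair 5 (Nat.pair (codeF φ) (codeF ψ))
  | _, .ex φ => Nat.pair 6 (codeF φ)

/-! ### Ordinals, von Neumann naturals -/

/-- `x` is a (von Neumann) ordinal: a transitive set of transitive sets. -/
def IsOrd (x : ZFSet.{0}) : Prop :=
  x.IsTransitive ∧ ∀ y ∈ x, ZFSet.IsTransitive y

/-- `x` is a limit ordinal. -/
def IsLimitOrd (x : ZFSet.{0}) : Prop :=
  IsOrd x ∧ x ≠ ∅ ∧ ∀ y ∈ x, ∃ z ∈ x, y ∈ z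

/-- The `n`-th von Neumann natural number. -/
def natZ : ℕ → ZFSet.{0}
  | 0 => ∅
  | n + 1 => insert (natZ n) (natZ n)

/-- Decoding of von Neumann naturals. -/
def zfToNat (x : ZFSet.{0}) : ℕ :=
  if h : ∃ n : ℕ, natZ n = x then h.choose else 0

/-! ### Coded functions, products -/

/-- The cartesian product of two `ZFSet.{0}`s (as a set of Kuratowski pairs). -/
def prodZ (a b : ZFSet.{0}) : ZFSet.{0} :=
  ZFSet.sep (fun z => ∃ x, x ∈ a ∧ ∃ y, y ∈ b ∧ z = ZFSet.pair x y)
    (ZFSet.powerset (ZFSet.powerset (a ∪ b)))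

/-- `f` codes a surjection from `a` onto `b`. -/
def IsSurjF (a b f : ZFSet.{0}) : Prop :=
  ZFSet.IsFunc a b f ∧ ∀ y, y ∈ b → ∃ x, x ∈ a ∧ ZFSet.pair x y ∈ f

/-- `f` codes an injection from `a` into `b`. -/
def IsInjF (a b f : ZFSet.{0}) : Prop :=
  ZFSet.IsFunc a b f ∧
    ∀ x₁, x₁ ∈ a → ∀ x₂, x₂ ∈ a → ∀ y, ZFSet.pair x₁ y ∈ f → ZFSet.pair x₂ y ∈ f → x₁ = x₂

/-- The set of values of a coded function `f`. -/
def imageOf (f : ZFSet.{0}) : ZFSet.{0} :=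
  ZFSet.sep (fun y => ∃ x, ZFSet.pair x y ∈ f) (ZFSet.sUnion (ZFSet.sUnion f))

/-! ### Cardinals (in `V`) -/

/-- `x` and `y` are equinumerous. -/
def EqNum (x y : ZFSet.{0}) : Prop := Nonempty (x.toSet ≃ y.toSet)

/-- `|x| ≤ |y|`. -/
def CardLE (x y : ZFSet.{0}) : Prop := Nonempty (x.toSet ↪ y.toSet)

/-- `|x| < κ`, for `κ` a cardinal: `x` injects into some member of `κ`. -/
def CardLT (x κ : ZFSet.{0}) : Prop := ∃ α, α ∈ κ ∧ CardLE x α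

/-- `κ` is a cardinal (of `V`). -/
def IsCard (κ : ZFSet.{0}) : Prop := IsOrd κ ∧ ∀ α ∈ κ, ¬ EqNum α κ

/-- `x` is unbounded (cofinal) in the ordinal `κ`. -/
def UnbIn (x κ : ZFSet.{0}) : Prop := ∀ β ∈ κ, ∃ γ ∈ x, β ∈ γ ∨ β = γ

/-- `κ` is a regular cardinal: every cofinal subset of `κ` has size `κ`. -/
def IsRegular (κ : ZFSet.{0}) : Prop :=
  IsCard κ ∧ ∀ x : ZFSet.{0}, x ⊆ κ → UnbIn x κ → EqNum x κ

/-- The least ordinal satisfying `p` (junk value `∅` if there is none). -/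
def leastOrd (p : ZFSet.{0} → Prop) : ZFSet.{0} :=
  if h : ∃ α, (IsOrd α ∧ p α) ∧ ∀ β ∈ α, ¬ (IsOrd β ∧ p β) then h.choose else ∅

/-- The cardinal `ℵₙ` of `V` (`Aleph 0 = ω`). -/
def Aleph : ℕ → ZFSet.{0}
  | 0 => ZFSet.omega
  | n + 1 => leastOrd (fun κ => IsCard κ ∧ Aleph n ∈ κ)

/-- The cardinal successor (in `V`) of `κ`. -/
def SuccCard (κ : ZFSet.{0}) : ZFSet.{0} := leastOrd (fun α => IsCard α ∧ κ ∈ α)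

/-- `X` is countable. -/
def Ctbl (X : ZFSet.{0}) : Prop := X.toSet.Countable

/-- `|X| = ω`: `X` is countably infinite. -/
def CtblInf (X : ZFSet.{0}) : Prop := X.toSet.Countable ∧ X.toSet.Infinite

/-! ### `H_κ`, elementary submodels, transitive collapse -/

/-- The class `H_κ` of sets hereditarily of cardinality `< κ`. -/
def Hset (κ : ZFSet.{0}) : Set ZFSet.{0} :=
  {x | ∃ t : ZFSet.{0}, t.IsTransitive ∧ x ∈ t ∧ CardLT t κ}

/-- `X ≺ S`: `X` is an elementary submodel of the class `(S, ∈)`. -/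
def ElemSub (X : ZFSet.{0}) (S : Set ZFSet.{0}) : Prop :=
  X.toSet ⊆ S ∧ ∀ {n : ℕ} (φ : Fml n) (v : Fin n → ZFSet.{0}),
    (∀ i, v i ∈ X) → (Sat X.toSet φ v ↔ Sat S φ v)

/-- The transitive-collapse map of (the ∈-structure on) `X`:
`collapse X y = {collapse X z | z ∈ y ∩ X}`.  For `γ ∈ X`, `collapse X γ` is
the image `γ̄` of `γ` under the transitive collapse of `X`. -/
def collapse (X : ZFSet.{0}) : ZFSet.{0} → ZFSet.{0} :=
  ZFSet.mem_wf.fix (C := fun _ => ZFSet.{0}) fun y ih =>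
    img (fun z => if h : z ∈ y then ih z h else ∅) (ZFSet.sep (fun z => z ∈ X) y)

/-- The transitive collapse of `X` (as a set). -/
def collapseSet (X : ZFSet.{0}) : ZFSet.{0} := img (fun y => collapse X y) X

/-- The transitive closure of (the members of) `x`. -/
def tcl : ZFSet.{0} → ZFSet.{0} :=
  ZFSet.mem_wf.fix (C := fun _ => ZFSet.{0}) fun x ih =>
    x ∪ ZFSet.sUnion (img (fun y => if h : y ∈ x then ih y h else ∅) x)

/-- The (von Neumann) rank of a set, as an ordinal `ZFSet.{0}`. -/
def rankZ : ZFSet.{0} → ZFSet.{0} :=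
  ZFSet.mem_wf.fix (C := fun _ => ZFSet.{0}) fun x ih =>
    ZFSet.sUnion (img (fun y => if h : y ∈ x then insert (ih y h) (ih y h) else ∅) x)

/-- The order type of a set `X` of ordinals: the unique ordinal `α` such that
`(X, ∈) ≅ (α, ∈)` (junk value `∅` if there is none). -/
def otype (X : ZFSet.{0}) : ZFSet.{0} :=
  if h : ∃ α, IsOrd α ∧ ∃ e : X.toSet ≃ α.toSet,
      ∀ a b : X.toSet, (a : ZFSet.{0}) ∈ (b : ZFSet.{0}) ↔ ((e a : ZFSet.{0}) ∈ (e b : ZFSet.{0}))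
  then h.choose else ∅

/-! ### The constructible hierarchy (relative to a predicate) -/

/-- The set of subsets of `X` definable over `(X, ∈, A)` with parameters. -/
def DefSetA (A : Set ZFSet.{0}) (X : ZFSet.{0}) : ZFSet.{0} :=
  ZFSet.sep (fun B => ∃ (n : ℕ) (φ : Fml (n + 1)) (v : Fin n → ZFSet.{0}),
      (∀ i, v i ∈ X) ∧ B = ZFSet.sep (fun z => SatAB X.toSet A ∅ φ (Fin.cons z v)) X)
    (ZFSet.powerset X)

/-- The hierarchy `L_α[A]`: `LstageA A α = ⋃_{β ∈ α} Def_A (LstageA A β)`. -/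
def LstageA (A : Set ZFSet.{0}) : ZFSet.{0} → ZFSet.{0} :=
  ZFSet.mem_wf.fix (C := fun _ => ZFSet.{0}) fun α ih =>
    ZFSet.sUnion (img (fun β => if h : β ∈ α then DefSetA A (ih β h) else ∅) α)

/-- Gödel's hierarchy `L_α`. -/
def Lstage : ZFSet.{0} → ZFSet.{0} := LstageA ∅

/-- The constructible universe `L`, as a class. -/
def LClass : Set ZFSet.{0} := {x | ∃ α, IsOrd α ∧ x ∈ Lstage α}

/-- The class `L[A]`, for a set `A`. -/
def LrelClass (A : ZFSet.{0}) : Set ZFSet.{0} := {x | ∃ α, IsOrd α ∧ x ∈ LstageA A.toSet α}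

/-- The constructible universe as computed inside a transitive (set or class)
model `W`: the union of the `L_α` for `α` an ordinal of `W`. -/
def LClassIn (W : Set ZFSet.{0}) : Set ZFSet.{0} :=
  {x | ∃ α, IsOrd α ∧ α ∈ W ∧ x ∈ Lstage α}

/-- `κ` is a cardinal in the (transitive) class `W`:
no coded surjection lying in `W` maps some `α < κ` onto `κ`. -/
def CardIn (W : Set ZFSet.{0}) (κ : ZFSet.{0}) : Prop :=
  IsOrd κ ∧ ∀ α, α ∈ κ → ∀ f, f ∈ W → ¬ IsSurjF α κ f

/-- `κ` is an `L`-cardinal. -/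
def LCard (κ : ZFSet.{0}) : Prop := CardIn LClass κ

/-! ### Clubs and stationarity on `[S]^ω` and on `κ` -/

/-- The union of an `ℕ`-indexed family of `ZFSet.{0}`s. -/
def seqUnion (f : ℕ → ZFSet.{0}) : ZFSet.{0} :=
  ZFSet.sUnion (img (fun m => f (zfToNat m)) ZFSet.omega)

/-- `C` is a club of countable subsets of `S`: every member is a countable
subset of `S`, `C` is `⊆`-cofinal in the countable subsets of `S`, and `C` is
closed under unions of countable increasing chains. -/
def ClubSub (S : Set ZFSet.{0}) (C : Set ZFSet.{0}) : Prop :=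
  (∀ X ∈ C, (X : ZFSet.{0}).toSet ⊆ S ∧ CtblInf X) ∧
  (∀ X : ZFSet.{0}, X.toSet ⊆ S → CtblInf X → ∃ Y ∈ C, X ⊆ Y) ∧
  (∀ f : ℕ → ZFSet.{0}, (∀ n, f n ∈ C) → (∀ n, f n ⊆ f (n + 1)) → seqUnion f ∈ C)

/-- `C` is stationary in `[S]^ω`: it meets every club of countable subsets. -/
def StatSub (S : Set ZFSet.{0}) (C : Set ZFSet.{0}) : Prop :=
  ∀ D : Set ZFSet.{0}, ClubSub S D → ∃ X, X ∈ C ∧ X ∈ D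

/-- `D` is a club (closed unbounded set) in the ordinal `κ`. -/
def ClubIn (κ D : ZFSet.{0}) : Prop :=
  D ⊆ κ ∧ (∀ β ∈ κ, ∃ θ, θ ∈ D ∧ β ∈ θ) ∧
  ∀ α, α ∈ κ → α ≠ ∅ → (∀ β ∈ α, ∃ θ, θ ∈ D ∧ θ ∈ α ∧ (β ∈ θ ∨ β = θ)) → α ∈ D

/-- `D` is stationary in the ordinal `κ`. -/
def StatIn (κ D : ZFSet.{0}) : Prop :=
  D ⊆ κ ∧ ∀ C : ZFSet.{0}, ClubIn κ C → ∃ θ, θ ∈ D ∧ θ ∈ C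

/-! ### The strong and weak reflecting properties -/

/-- `SRP^M(γ)` for an inner model given as a class `W`:  for some regular
cardinal `κ > γ`, whenever `X ≺ H_κ` is countable with `γ ∈ X`, the image of
`γ` under the transitive collapse of `X` is a cardinal of `W`. -/
def SRPclass (W : Set ZFSet.{0}) (γ : ZFSet.{0}) : Prop :=
  ∃ κ, IsRegular κ ∧ γ ∈ κ ∧
    ∀ X : ZFSet.{0}, ElemSub X (Hset κ) → CtblInf X → γ ∈ X → CardIn W (collapse X γ)

/-- `SRP^L(γ)`: the strong reflecting property for `L`-cardinals. -/
def SRPL (γ : ZFSet.{0}) : Prop := SRPclass LClass γ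

/-- `WRP^L(γ)`: the weak reflecting property for `L`-cardinals. -/
def WRPL (γ : ZFSet.{0}) : Prop :=
  ∃ κ, IsRegular κ ∧ γ ∈ κ ∧
    ∃ X : ZFSet.{0}, ElemSub X (Hset κ) ∧ CtblInf X ∧ γ ∈ X ∧ LCard (collapse X γ)

/-- `SRP^M_{<λ}(λ)`: for some regular `θ > λ`, every `X ≺ H_θ` with `|X| < λ`
and `λ ∈ X` collapses `λ` to a `W`-cardinal. -/
def SRPlt (W : Set ZFSet.{0}) (lam : ZFSet.{0}) : Prop :=
  ∃ θ, IsRegular θ ∧ lam ∈ θ ∧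
    ∀ X : ZFSet.{0}, ElemSub X (Hset θ) → CardLT X lam → lam ∈ X → CardIn W (collapse X lam)

/-! ### Notions relativized to a transitive (set or class) model `W` -/

/-- `κ` is a regular cardinal in `W`: `κ` is a `W`-cardinal and every coded
function in `W` from some `α < κ` into `κ` is bounded. -/
def RegularIn (W : Set ZFSet.{0}) (κ : ZFSet.{0}) : Prop :=
  CardIn W κ ∧ ∀ α, α ∈ κ → ∀ f, f ∈ W → ZFSet.IsFunc α κ f →
    ∃ β, β ∈ κ ∧ ∀ ξ y, ξ ∈ α → ZFSet.pair ξ y ∈ f → y ∈ β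

/-- `H_κ` as computed in `W`. -/
def HsetIn (W : Set ZFSet.{0}) (κ : ZFSet.{0}) : Set ZFSet.{0} :=
  {x | x ∈ W ∧ ∃ t, t ∈ W ∧ t.IsTransitive ∧ x ∈ t ∧
    ∃ f, f ∈ W ∧ ∃ α, α ∈ κ ∧ IsInjF t α f}

/-- `X` is countable in `W`. -/
def CtblIn (W : Set ZFSet.{0}) (X : ZFSet.{0}) : Prop :=
  X = ∅ ∨ ∃ f, f ∈ W ∧ IsSurjF ZFSet.omega X f

/-- `|X| = ω` in `W`: countable and infinite in `W`. -/
def CtblInfIn (W : Set ZFSet.{0}) (X : ZFSet.{0}) : Prop :=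
  CtblIn W X ∧ ∀ n, n ∈ ZFSet.omega → ∀ f, f ∈ W → ¬ IsSurjF n X f

/-- The `ω₁` of `W`. -/
def omega1In (W : Set ZFSet.{0}) : ZFSet.{0} :=
  leastOrd (fun α => CardIn W α ∧ ZFSet.omega ∈ α)

/-- The `ω₂` of `W`. -/
def omega2In (W : Set ZFSet.{0}) : ZFSet.{0} :=
  leastOrd (fun α => CardIn W α ∧ omega1In W ∈ α)

/-- The cardinal successor of `κ` as computed in `W`. -/
def SuccCardIn (W : Set ZFSet.{0}) (κ : ZFSet.{0}) : ZFSet.{0} :=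
  leastOrd (fun α => CardIn W α ∧ κ ∈ α)

/-- `WRP^L(γ)` as computed inside the (transitive) model `W`:  for some
`κ ∈ W` regular in `W` with `γ < κ` there is an `X ∈ W`, countably infinite
in `W`, with `X ≺ H_κ^W`, `γ ∈ X`, whose collapse sends `γ` to a cardinal of
the `L` of `W`. -/
def WRPLIn (W : Set ZFSet.{0}) (γ : ZFSet.{0}) : Prop :=
  ∃ κ, κ ∈ W ∧ RegularIn W κ ∧ γ ∈ κ ∧
    ∃ X, X ∈ W ∧ ElemSub X (HsetIn W κ) ∧ CtblInfIn W X ∧ γ ∈ X ∧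
      CardIn (LClassIn W) (collapse X γ)

/-- `SRP^L(γ)` as computed inside the (transitive) model `W`. -/
def SRPLIn (W : Set ZFSet.{0}) (γ : ZFSet.{0}) : Prop :=
  ∃ κ, κ ∈ W ∧ RegularIn W κ ∧ γ ∈ κ ∧
    ∀ X, X ∈ W → ElemSub X (HsetIn W κ) → CtblInfIn W X → γ ∈ X →
      CardIn (LClassIn W) (collapse X γ)

/-! ### Models of (fragments of) ZFC, semantically -/

/-- `W` is a transitive model of `ZFC⁻` (ZFC with Power Set deleted and with
Collection), rendered semantically: nonempty, transitive, closed under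
pairing and union, contains `ω`, satisfies full Separation and Collection for
first-order formulas with parameters, and Choice. -/
def ModelsZFCminus (W : Set ZFSet.{0}) : Prop :=
  (∃ x, x ∈ W) ∧
  (∀ x, x ∈ W → x.toSet ⊆ W) ∧
  (∀ x y, x ∈ W → y ∈ W → insert x (insert y (∅ : ZFSet.{0})) ∈ W) ∧
  (∀ x, x ∈ W → ZFSet.sUnion x ∈ W) ∧
  (ZFSet.omega ∈ W) ∧
  (∀ (n : ℕ) (φ : Fml (n + 1)) (v : Fin n → ZFSet.{0}), (∀ i, v i ∈ W) → ∀ a, a ∈ W →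
    ZFSet.sep (fun z => SatAB W ∅ ∅ φ (Fin.cons z v)) a ∈ W) ∧
  (∀ (n : ℕ) (φ : Fml (n + 2)) (v : Fin n → ZFSet.{0}), (∀ i, v i ∈ W) → ∀ a, a ∈ W →
    (∀ x, x ∈ a → ∃ y, y ∈ W ∧ SatAB W ∅ ∅ φ (Fin.cons x (Fin.cons y v))) →
    ∃ b, b ∈ W ∧ ∀ x, x ∈ a → ∃ y, y ∈ b ∧ SatAB W ∅ ∅ φ (Fin.cons x (Fin.cons y v))) ∧
  (∀ x, x ∈ W → (∀ y, y ∈ x → y ≠ ∅) →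
    ∃ c, c ∈ W ∧ ∀ y, y ∈ x → ∃! z, z ∈ y ∧ ZFSet.pair y z ∈ c)

/-- `W` is a transitive model of `ZFC` (with Power Set). -/
def ModelsZFC (W : Set ZFSet.{0}) : Prop :=
  ModelsZFCminus W ∧ ∀ x, x ∈ W → ∃ p, p ∈ W ∧ ∀ z, z ∈ W → (z ∈ p ↔ z ⊆ x)

/-- `W` is a model of `Z₂ = ZFC⁻ +` "every set is countable". -/
def ModelsZ2 (W : Set ZFSet.{0}) : Prop :=
  ModelsZFCminus W ∧ ∀ x, x ∈ W → CtblIn W x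

/-- `p` is the power set of `x` as computed in `W`. -/
def IsPowIn (W : Set ZFSet.{0}) (x p : ZFSet.{0}) : Prop :=
  p ∈ W ∧ ∀ z, z ∈ W → (z ∈ p ↔ z ⊆ x)

/-- `W` is a model of `Z₃ = ZFC⁻ + 𝒫(ω)` exists `+` every set has size `≤ ℶ₁`. -/
def ModelsZ3 (W : Set ZFSet.{0}) : Prop :=
  ModelsZFCminus W ∧ (∃ p, IsPowIn W ZFSet.omega p) ∧
    ∀ x, x ∈ W → ∀ p, IsPowIn W ZFSet.omega p → ∃ f, f ∈ W ∧ IsInjF x p f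

/-- `W` is a model of `Z₄ = ZFC⁻ + 𝒫(𝒫(ω))` exists `+` every set has size `≤ ℶ₂`. -/
def ModelsZ4 (W : Set ZFSet.{0}) : Prop :=
  ModelsZFCminus W ∧
    (∃ p q, IsPowIn W ZFSet.omega p ∧ IsPowIn W p q) ∧
    ∀ x, x ∈ W → ∀ p q, IsPowIn W ZFSet.omega p → IsPowIn W p q →
      ∃ f, f ∈ W ∧ IsInjF x q f

/-! ### Forcing: the Lévy collapse, genericity, generic extensions -/

/-- The Lévy collapse `Col(ω, <κ)`: finite partial functions `p` with
`p(α, n) ∈ α` for `α < κ`, `n < ω`. -/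
def ColLt (κ : ZFSet.{0}) : ZFSet.{0} :=
  ZFSet.sep (fun p => p.toSet.Finite ∧
      (∀ z, z ∈ p → ∃ α n β, α ∈ κ ∧ n ∈ ZFSet.omega ∧ β ∈ α ∧
        z = ZFSet.pair (ZFSet.pair α n) β) ∧
      (∀ α n β β', ZFSet.pair (ZFSet.pair α n) β ∈ p →
        ZFSet.pair (ZFSet.pair α n) β' ∈ p → β = β'))
    (ZFSet.powerset (prodZ (prodZ κ ZFSet.omega) (ZFSet.sUnion κ)))

/-- `G` is a filter on the partial order `P` of partial functions ordered by
reverse inclusion (`p` is stronger than `q` iff `q ⊆ p`) which meets every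
dense subset of `P` lying in the (transitive) model `W`. -/
def GenericOver (W : Set ZFSet.{0}) (P G : ZFSet.{0}) : Prop :=
  G ⊆ P ∧
  (∀ p q, p ∈ G → q ∈ P → q ⊆ p → q ∈ G) ∧
  (∀ p q, p ∈ G → q ∈ G → ∃ r, r ∈ G ∧ p ⊆ r ∧ q ⊆ r) ∧
  (∀ D, D ∈ W → D ⊆ P → (∀ p, p ∈ P → ∃ q, q ∈ D ∧ p ⊆ q) → ∃ q, q ∈ G ∧ q ∈ D)

/-- Genericity for an abstract partial order `R` (a set of pairs) on `P`:
`pair p q ∈ R` means `p` is stronger than (extends) `q`. -/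
def GenericOnP (W : Set ZFSet.{0}) (P R G : ZFSet.{0}) : Prop :=
  G ⊆ P ∧
  (∀ p q, p ∈ G → q ∈ P → ZFSet.pair p q ∈ R → q ∈ G) ∧
  (∀ p q, p ∈ G → q ∈ G → ∃ r, r ∈ G ∧ ZFSet.pair r p ∈ R ∧ ZFSet.pair r q ∈ R) ∧
  (∀ D, D ∈ W → D ⊆ P → (∀ p, p ∈ P → ∃ q, q ∈ D ∧ ZFSet.pair q p ∈ R) →
    ∃ q, q ∈ G ∧ q ∈ D)

/-- Evaluation of a forcing name `τ` by a filter `G`: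
`nameVal G τ = {nameVal G σ | ∃ p ∈ G, (σ, p) ∈ τ}`. -/
def nameVal (G : ZFSet.{0}) : ZFSet.{0} → ZFSet.{0} :=
  (ZFSet.mem_wf.transGen).fix (C := fun _ => ZFSet.{0}) fun τ ih =>
    img (fun σ => if h : Relation.TransGen (· ∈ ·) σ τ then ih σ h else ∅)
      (ZFSet.sep (fun σ => ∃ p, p ∈ G ∧ ZFSet.pair σ p ∈ τ)
        (ZFSet.sUnion (ZFSet.sUnion τ)))

/-- The generic extension `M[G]` of a transitive set model `M`, via names. -/
def extSet (M G : ZFSet.{0}) : Set ZFSet.{0} := {x | ∃ τ, τ ∈ M ∧ x = nameVal G τ}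

/-! ### Remarkable cardinals (Schindler), relative to a ground model class -/

/-- Clubs of countable subsets of `S`, as computed in the (transitive) model
`E`: the club is coded by a set `D ∈ E`, its members are subsets of `S`
countably infinite in `E`, it is cofinal among such sets lying in `E`, and it
is closed under unions of increasing `ω`-chains coded in `E`. -/
def ClubSubIn (E : Set ZFSet.{0}) (S : Set ZFSet.{0}) (D : ZFSet.{0}) : Prop :=
  D ∈ E ∧
  (∀ X, X ∈ D → X.toSet ⊆ S ∧ CtblInfIn E X) ∧
  (∀ X : ZFSet.{0}, X ∈ E → X.toSet ⊆ S → CtblInfIn E X → ∃ Y, Y ∈ D ∧ X ⊆ Y) ∧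
  (∀ g, g ∈ E → ZFSet.IsFunc ZFSet.omega D g →
    (∀ n y y', n ∈ ZFSet.omega → ZFSet.pair n y ∈ g →
      ZFSet.pair (insert n n) y' ∈ g → y ⊆ y') →
    ZFSet.sUnion (imageOf g) ∈ D)

/-- Stationarity of a collection `C` of countable subsets of `S`, as computed
in the model `E`. -/
def StatSubIn (E : Set ZFSet.{0}) (S : Set ZFSet.{0}) (C : Set ZFSet.{0}) : Prop :=
  ∀ D : ZFSet.{0}, ClubSubIn E S D → ∃ X, X ∈ C ∧ X ∈ D

/-- `X` condenses remarkably (with ground model `W`, extension operation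
`Ext` sending a generic object to the corresponding extension of `W`,
collapse height `δ`, target `θ`, and generic `G`):  `X = ran(π)` for some
elementary `π : (H_β^{W[G∩H_α^W]}, ∈, H_β^W, G∩H_α^W) → (H_θ^{W[G]}, ∈, H_θ^W, G)`
with `α = crit(π) < β < δ` and `β` a cardinal of `W`. -/
def CondensesRemarkably (W : Set ZFSet.{0}) (Ext : ZFSet.{0} → Set ZFSet.{0})
    (δ θ G X : ZFSet.{0}) : Prop :=
  ∃ (f : ZFSet.{0} → ZFSet.{0}) (α β : ZFSet.{0}), IsOrd α ∧ α ∈ β ∧ β ∈ δ ∧ CardIn W β ∧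
    (∀ ξ, ξ ∈ α → f ξ = ξ) ∧ f α ≠ α ∧
    (let Gα : ZFSet.{0} := ZFSet.sep (fun p => p ∈ HsetIn W α) G
     let Dom : Set ZFSet.{0} := HsetIn (Ext Gα) β
     let Cod : Set ZFSet.{0} := HsetIn (Ext G) θ
     Set.MapsTo f Dom Cod ∧ X.toSet = f '' Dom ∧
     ∀ (n : ℕ) (φ : Fml n) (v : Fin n → ZFSet.{0}), (∀ i, v i ∈ Dom) →
       (SatAB Dom W Gα.toSet φ v ↔ SatAB Cod W G.toSet φ (f ∘ v)))

/-- `δ` is `θ`-remarkable, in the sense of the (transitive) ground model `W`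
with extensions given by `Ext`: for every `G` which is `Col(ω, <δ)`-generic
over `W`, in `W[G]` the set of countable `X ⊆ H_θ^{W[G]}` which condense
remarkably is stationary. -/
def ThetaRemarkableVia (W : Set ZFSet.{0}) (Ext : ZFSet.{0} → Set ZFSet.{0})
    (δ θ : ZFSet.{0}) : Prop :=
  ∀ G, GenericOver W (ColLt δ) G →
    StatSubIn (Ext G) (HsetIn (Ext G) θ)
      {X | CondensesRemarkably W Ext δ θ G X}

/-- `δ` is remarkable in the sense of `(W, Ext)`:  `θ`-remarkable for every
regular (in `W`) `θ > δ`. -/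
def RemarkableVia (W : Set ZFSet.{0}) (Ext : ZFSet.{0} → Set ZFSet.{0}) (δ : ZFSet.{0}) : Prop :=
  ∀ θ, RegularIn W θ → δ ∈ θ → ThetaRemarkableVia W Ext δ θ

/-! ### Indiscernibles and sharps -/

/-- `I` is a set (or class) of ordinal indiscernibles for the structure
`(S, ∈, A)`. -/
def IndiscFor (S A : Set ZFSet.{0}) (I : Set ZFSet.{0}) : Prop :=
  (∀ x ∈ I, IsOrd x ∧ x ∈ S) ∧
  ∀ (n : ℕ) (φ : Fml n) (v w : Fin n → ZFSet.{0}),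
    (∀ i, v i ∈ I) → (∀ i, w i ∈ I) →
    (∀ i j : Fin n, i < j → v i ∈ v j) → (∀ i j : Fin n, i < j → w i ∈ w j) →
    (SatAB S A ∅ φ v ↔ SatAB S A ∅ φ w)

/-- `0♯` exists: for some uncountable limit ordinal `λ`, `L_λ` has an
uncountable set of indiscernibles. -/
def ZeroSharpExists : Prop :=
  ∃ lam : ZFSet.{0}, IsLimitOrd lam ∧ ¬ lam.toSet.Countable ∧
    ∃ I : ZFSet.{0}, ¬ I.toSet.Countable ∧ IndiscFor (Lstage lam).toSet ∅ I.toSet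

/-- The sharp of `L[A]` exists: for some uncountable limit ordinal `λ`, the
structure `(L_λ[A], ∈, A)` has an uncountable set of indiscernibles. -/
def SharpOverExists (A : ZFSet.{0}) : Prop :=
  ∃ lam : ZFSet.{0}, IsLimitOrd lam ∧ ¬ lam.toSet.Countable ∧
    ∃ I : ZFSet.{0}, ¬ I.toSet.Countable ∧
      IndiscFor (LstageA A.toSet lam).toSet A.toSet I.toSet

/-- `I` is a closed unbounded proper class of ordinals. -/
def ProperClassClub (I : Set ZFSet.{0}) : Prop :=
  (∀ x ∈ I, IsOrd x) ∧
  (∀ α, IsOrd α → ∃ β, IsOrd β ∧ α ∈ β ∧ β ∈ I) ∧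
  (∀ α, IsOrd α → α ≠ ∅ → (∀ β ∈ α, ∃ θ, θ ∈ I ∧ θ ∈ α ∧ (β ∈ θ ∨ β = θ)) → α ∈ I)

/-- `s` is (a real coding) `0♯`: there is a closed unbounded proper class `I`
of Silver indiscernibles for `L` and `s` is the set of codes of formulas
satisfied in `L` by increasing tuples from `I`. -/
def IsZeroSharpReal (s : ZFSet.{0}) : Prop :=
  s ⊆ ZFSet.omega ∧
  ∃ I : Set ZFSet.{0}, ProperClassClub I ∧ IndiscFor LClass ∅ I ∧
    s = ZFSet.sep (fun m => ∃ (n : ℕ) (φ : Fml n) (v : Fin n → ZFSet.{0}),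
          (∀ i, v i ∈ I) ∧ (∀ i j : Fin n, i < j → v i ∈ v j) ∧
          Sat LClass φ v ∧ m = natZ (Nat.pair n (codeF φ))) ZFSet.omega

/-! ### Admissible ordinals and Harrington's Principle -/

/-- The (graph of the) function `f` is `Σ₁`-definable with parameters over the
structure `(S, ∈)`. -/
def Sigma1DefOver (S : Set ZFSet.{0}) (f : ZFSet.{0} → ZFSet.{0}) : Prop :=
  ∃ (n : ℕ) (ψ : Fml (n + 3)), IsDelta0 ψ ∧
    ∃ p : Fin n → ZFSet.{0}, (∀ i, p i ∈ S) ∧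
      ∀ a b, a ∈ S → b ∈ S →
        (f a = b ↔ Sat S (Fml.ex ψ) (Fin.cons a (Fin.cons b p)))

/-- `α` is `x`-admissible: `α > ω` is a limit ordinal and no
`Σ₁(L_α[x])`-definable function maps some `δ < α` cofinally into `α`. -/
def Admissible (x α : ZFSet.{0}) : Prop :=
  IsLimitOrd α ∧ ZFSet.omega ∈ α ∧
  ¬ ∃ δ, δ ∈ α ∧ ∃ f : ZFSet.{0} → ZFSet.{0},
      Sigma1DefOver (LstageA x.toSet α).toSet f ∧
      (∀ β, β ∈ δ → f β ∈ α) ∧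
      ∀ ξ, ξ ∈ α → ∃ β, β ∈ δ ∧ (ξ ∈ f β ∨ ξ = f β)

/-- The generalized Harrington Principle `HP(M)` for the inner model given by
the class `W`: there is a real `x` such that every `x`-admissible ordinal is a
cardinal of `W`. -/
def HPclass (W : Set ZFSet.{0}) : Prop :=
  ∃ x : ZFSet.{0}, x ⊆ ZFSet.omega ∧ ∀ α, Admissible x α → CardIn W α

/-- Harrington's Principle `HP(L)`. -/
def HPL : Prop := HPclass LClass

/-- `HP(L)` as computed inside the (transitive) model `W`. -/
def HPLIn (W : Set ZFSet.{0}) : Prop :=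
  ∃ x, x ∈ W ∧ x ⊆ ZFSet.omega ∧
    ∀ α, α ∈ W → Admissible x α → CardIn (LClassIn W) α

/-! ### Inner models, elementary embeddings, rigidity, covering -/

/-- `W` is an inner model: a transitive proper class containing all ordinals
and satisfying ZFC. -/
def InnerModelClass (W : Set ZFSet.{0}) : Prop :=
  (∀ x, x ∈ W → x.toSet ⊆ W) ∧ (∀ α : ZFSet.{0}, IsOrd α → α ∈ W) ∧ ModelsZFC W

/-- `j` is an elementary embedding of the class `(W, ∈)` into itself. -/
def ElemEmbOn (W : Set ZFSet.{0}) (j : ZFSet.{0} → ZFSet.{0}) : Prop :=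
  Set.MapsTo j W W ∧
  ∀ (n : ℕ) (φ : Fml n) (v : Fin n → ZFSet.{0}),
    (∀ i, v i ∈ W) → (Sat W φ v ↔ Sat W φ (j ∘ v))

/-- `W` has the rigidity property: there is no nontrivial elementary embedding
from `W` to `W`. -/
def RigidClass (W : Set ZFSet.{0}) : Prop :=
  ¬ ∃ j : ZFSet.{0} → ZFSet.{0}, ElemEmbOn W j ∧ ∃ x, x ∈ W ∧ j x ≠ x

/-- `W` has the full covering property: every set `X` of ordinals is covered
by some `Y ∈ W` with `|Y| = |X| + ω₁`. -/
def FullCovering (W : Set ZFSet.{0}) : Prop :=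
  ∀ X : ZFSet.{0}, (∀ z ∈ X, IsOrd z) →
    ∃ Y, Y ∈ W ∧ X ⊆ Y ∧ Nonempty (Y.toSet ≃ (X.toSet ⊕ (Aleph 1).toSet))

/-- The restriction `M|θ` of the inner model `W`: its elements of rank `< θ`. -/
def restrictTo (W : Set ZFSet.{0}) (θ : ZFSet.{0}) : Set ZFSet.{0} :=
  {x | x ∈ W ∧ rankZ x ∈ θ}

/-- The class `S` is definable (with parameters) in `H_θ`. -/
def DefinableInH (θ : ZFSet.{0}) (S : Set ZFSet.{0}) : Prop :=
  ∃ (n : ℕ) (φ : Fml (n + 1)) (v : Fin n → ZFSet.{0}),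
    (∀ i, v i ∈ Hset θ) ∧ ∀ x, x ∈ Hset θ → (x ∈ S ↔ Sat (Hset θ) φ (Fin.cons x v))

/-- `ν` is weakly inaccessible in `W`: a regular limit cardinal of `W`. -/
def WeaklyInaccIn (W : Set ZFSet.{0}) (ν : ZFSet.{0}) : Prop :=
  RegularIn W ν ∧ ZFSet.omega ∈ ν ∧
    ∀ β, β ∈ ν → ∃ δ, δ ∈ ν ∧ β ∈ δ ∧ CardIn W δ

/-! ### Measures, `κ`-models and `0†` -/

/-- `⟨L[U], ∈, U⟩ ⊨ "U is a normal ultrafilter over κ"`:  `L[U]` is a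
`κ`-model. -/
def IsKappaModel (κ U : ZFSet.{0}) : Prop :=
  IsOrd κ ∧ ZFSet.omega ∈ κ ∧ U ∈ LrelClass U ∧
  (∀ X, X ∈ U → X ⊆ κ ∧ X ∈ LrelClass U) ∧ κ ∈ U ∧ (∅ : ZFSet.{0}) ∉ U ∧
  (∀ X Y, X ∈ U → Y ∈ U → X ∩ Y ∈ U) ∧
  (∀ X Y, X ∈ U → Y ∈ LrelClass U → X ⊆ Y → Y ⊆ κ → Y ∈ U) ∧
  (∀ X, X ∈ LrelClass U → X ⊆ κ → (X ∈ U ∨ κ \ X ∈ U)) ∧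
  (∀ α, α ∈ κ → (insert α ∅ : ZFSet.{0}) ∉ U) ∧
  (∀ δ g, δ ∈ κ → g ∈ LrelClass U → ZFSet.IsFunc δ (ZFSet.powerset κ) g →
    (∀ ξ y, ZFSet.pair ξ y ∈ g → y ∈ U) →
    ZFSet.sep (fun β => ∀ ξ, ξ ∈ δ → ∀ y, ZFSet.pair ξ y ∈ g → β ∈ y) κ ∈ U) ∧
  (∀ f X, f ∈ LrelClass U → X ∈ U → ZFSet.IsFunc κ κ f →
    (∀ α, α ∈ X → α ≠ ∅ → ∀ y, ZFSet.pair α y ∈ f → y ∈ α) →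
    ∃ β Y, β ∈ κ ∧ Y ∈ U ∧ ∀ α, α ∈ Y → ZFSet.pair α β ∈ f)

/-- `0†` exists: there is a `κ`-model (for some `κ`) and a nontrivial
elementary embedding from that model to itself with critical point
greater than `κ`. -/
def ZeroDaggerExists : Prop :=
  ∃ κ U : ZFSet.{0}, IsKappaModel κ U ∧
    ∃ j : ZFSet.{0} → ZFSet.{0}, ElemEmbOn (LrelClass U) j ∧
      ∃ η, IsOrd η ∧ κ ∈ η ∧ (∀ β, β ∈ η → j β = β) ∧ j η ≠ η

/-- `U` witnesses that `κ` is a measurable cardinal (in `V`): `U` is a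
`κ`-complete nonprincipal normal ultrafilter on `κ`. -/
def IsMeasureOn (κ U : ZFSet.{0}) : Prop :=
  IsOrd κ ∧ ZFSet.omega ∈ κ ∧
  (∀ X, X ∈ U → X ⊆ κ) ∧ κ ∈ U ∧ (∅ : ZFSet.{0}) ∉ U ∧
  (∀ X Y, X ∈ U → Y ∈ U → X ∩ Y ∈ U) ∧
  (∀ X Y, X ∈ U → X ⊆ Y → Y ⊆ κ → Y ∈ U) ∧
  (∀ X : ZFSet.{0}, X ⊆ κ → (X ∈ U ∨ κ \ X ∈ U)) ∧
  (∀ α, α ∈ κ → (insert α ∅ : ZFSet.{0}) ∉ U) ∧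
  (∀ x : ZFSet.{0}, x.toSet ⊆ U.toSet → CardLT x κ → x ≠ ∅ →
    ZFSet.sep (fun β => ∀ y, y ∈ x → β ∈ y) κ ∈ U) ∧
  (∀ f X, X ∈ U → ZFSet.IsFunc κ κ f →
    (∀ α, α ∈ X → α ≠ ∅ → ∀ y, ZFSet.pair α y ∈ f → y ∈ α) →
    ∃ β Y, β ∈ κ ∧ Y ∈ U ∧ ∀ α, α ∈ Y → ZFSet.pair α β ∈ f)

/-- `κ` is a measurable cardinal. -/
def IsMeasurable (κ : ZFSet.{0}) : Prop := ∃ U, IsMeasureOn κ U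

/-- `U ∈ W` witnesses measurability of `κ` inside the inner model `W`. -/
def MeasurableIn (W : Set ZFSet.{0}) (κ U : ZFSet.{0}) : Prop :=
  U ∈ W ∧ IsOrd κ ∧ ZFSet.omega ∈ κ ∧
  (∀ X, X ∈ U → X ⊆ κ) ∧ κ ∈ U ∧ (∅ : ZFSet.{0}) ∉ U ∧
  (∀ X Y, X ∈ U → Y ∈ U → X ∩ Y ∈ U) ∧
  (∀ X Y, X ∈ U → Y ∈ W → X ⊆ Y → Y ⊆ κ → Y ∈ U) ∧
  (∀ X, X ∈ W → X ⊆ κ → (X ∈ U ∨ κ \ X ∈ U)) ∧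
  (∀ α, α ∈ κ → (insert α ∅ : ZFSet.{0}) ∉ U) ∧
  (∀ δ g, δ ∈ κ → g ∈ W → ZFSet.IsFunc δ (ZFSet.powerset κ) g →
    (∀ ξ y, ZFSet.pair ξ y ∈ g → y ∈ U) →
    ZFSet.sep (fun β => ∀ ξ, ξ ∈ δ → ∀ y, ZFSet.pair ξ y ∈ g → β ∈ y) κ ∈ U)

/-- There is an inner model with a measurable cardinal. -/
def ExistsInnerModelMeasurable : Prop :=
  ∃ W : Set ZFSet.{0}, InnerModelClass W ∧ ∃ κ U, MeasurableIn W κ U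

/-! ### Core-model-like inner models -/

/-- `W` satisfies the GCH. -/
def GCHIn (W : Set ZFSet.{0}) : Prop :=
  ∀ κ, CardIn W κ → (ZFSet.omega ∈ κ ∨ ZFSet.omega = κ) →
    ∃ f, f ∈ W ∧ IsInjF (ZFSet.sep (fun z => z ∈ W) (ZFSet.powerset κ))
      (SuccCardIn W κ) f

/-- `W` has the condensation property: the transitive collapse of any
elementary submodel of an initial segment of `W` is again an initial segment
of `W`. -/
def CondensationFor (W : Set ZFSet.{0}) : Prop :=
  ∀ θ : ZFSet.{0}, IsOrd θ → ∀ X : ZFSet.{0},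
    X.toSet ⊆ restrictTo W θ → ElemSub X (restrictTo W θ) →
    ∃ θ', IsOrd θ' ∧ (collapseSet X).toSet = restrictTo W θ'

/-- The properties of the Dodd–Jensen core model `K` (below a measurable
cardinal) which are relevant here: `K` is an inner model satisfying the GCH,
with condensation, and (by Dodd–Jensen, given that there is no inner model
with a measurable) the rigidity property. -/
def CoreModelProps (W : Set ZFSet.{0}) : Prop :=
  InnerModelClass W ∧ GCHIn W ∧ CondensationFor W ∧ RigidClass W

/-! ### `L(ℝ)`, determinacy, and `HOD` -/

/-- The base of the `L(ℝ)` hierarchy: the transitive closure of `{𝒫(ω)}`. -/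
def lrBase : ZFSet.{0} :=
  insert (ZFSet.powerset ZFSet.omega) (tcl (ZFSet.powerset ZFSet.omega))

/-- The hierarchy `L_α(ℝ)`. -/
def LRstage : ZFSet.{0} → ZFSet.{0} :=
  ZFSet.mem_wf.fix (C := fun _ => ZFSet.{0}) fun α ih =>
    lrBase ∪ ZFSet.sUnion
      (img (fun β => if h : β ∈ α then DefSetA ∅ (ih β h) else ∅) α)

/-- The class `L(ℝ)`. -/
def LRClass : Set ZFSet.{0} := {x | ∃ α, IsOrd α ∧ x ∈ LRstage α}

/-- The `ZFSet` coding the function `ω → ω` given by `g`. -/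
def seqCode (g : ℕ → ℕ) : ZFSet.{0} :=
  img (fun m => ZFSet.pair m (natZ (g (zfToNat m)))) ZFSet.omega

/-- The game on `ω` with payoff `A` (a set of coded functions `ω → ω`) is
determined: one of the two players has a winning strategy. -/
def DeterminedZ (A : ZFSet.{0}) : Prop :=
  (∃ σ : List ℕ → ℕ, ∀ g : ℕ → ℕ,
    (∀ n : ℕ, g (2 * n) = σ (List.ofFn (fun i : Fin (2 * n) => g i.val))) →
    seqCode g ∈ A) ∨
  (∃ τ : List ℕ → ℕ, ∀ g : ℕ → ℕ,
    (∀ n : ℕ, g (2 * n + 1) = τ (List.ofFn (fun i : Fin (2 * n + 1) => g i.val))) →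
    seqCode g ∉ A)

/-- `AD^{L(ℝ)}`: every set of reals in `L(ℝ)` is determined.  (Since every
real, and every strategy, belongs to `L(ℝ)`, this is equivalent to `L(ℝ) ⊨ AD`.) -/
def ADinLR : Prop :=
  ∀ A, A ∈ LRClass → (∀ f, f ∈ A → ZFSet.IsFunc ZFSet.omega ZFSet.omega f) →
    DeterminedZ A

/-- `x` is ordinal definable. -/
def IsOD (x : ZFSet.{0}) : Prop :=
  ∃ (n : ℕ) (φ : Fml (n + 1)) (v : Fin n → ZFSet.{0}),
    (∀ i, IsOrd (v i)) ∧ ∀ y, (Sat Set.univ φ (Fin.cons y v) ↔ y = x)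

/-- The class `HOD` of hereditarily ordinal definable sets. -/
def HODClass : Set ZFSet.{0} :=
  {x | IsOD x ∧ ∀ y, y ∈ tcl x → IsOD y}

/-- The class `L[A]` as computed inside the (transitive) model `W`. -/
def LrelClassIn (W : Set ZFSet.{0}) (A : ZFSet.{0}) : Set ZFSet.{0} :=
  {x | ∃ α, IsOrd α ∧ α ∈ W ∧ x ∈ LstageA A.toSet α}

/-! ### Definable predicates -/

theorem mem_img {f : ZFSet.{0} → ZFSet.{0}} {x y : ZFSet.{0}} :
    y ∈ img f x ↔ ∃ z ∈ x, f z = y := by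
  unfold img
  exact @ZFSet.mem_image f (Classical.allZFSetDefinable _) x y

/-- A class is transitive. -/
def TransCl (S : Set ZFSet.{0}) : Prop := ∀ x ∈ S, ∀ y ∈ x, y ∈ S

/-- `R` is uniformly first-order definable over the transitive classes in `𝒮`. -/
def Dfn (𝒮 : Set (Set ZFSet.{0})) {n : ℕ} (R : (Fin n → ZFSet.{0}) → Prop) : Prop :=
  ∃ φ : Fml n, ∀ S ∈ 𝒮, TransCl S → ∀ v : Fin n → ZFSet.{0}, (∀ i, v i ∈ S) →
    (Sat S φ v ↔ R v)

/-- `f` is a coordinate projection. -/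
def IsProj {n : ℕ} (f : (Fin n → ZFSet.{0}) → ZFSet.{0}) : Prop := ∃ i, f = fun v => v i

theorem IsProj.coord {n : ℕ} (i : Fin n) : IsProj (fun v => v i) := ⟨i, rfl⟩

section Dfn

variable {𝒮 : Set (Set ZFSet.{0})} {n : ℕ} {P Q : (Fin n → ZFSet.{0}) → Prop}
  {f g h : (Fin n → ZFSet.{0}) → ZFSet.{0}}

theorem Dfn.mem (hf : IsProj f) (hg : IsProj g) : Dfn 𝒮 (fun v => f v ∈ g v) := by
  obtain ⟨i, rfl⟩ := hf
  obtain ⟨j, rfl⟩ := hg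
  exact ⟨.mem i j, fun S _ _ v _ => Iff.rfl⟩

theorem Dfn.eq (hf : IsProj f) (hg : IsProj g) : Dfn 𝒮 (fun v => f v = g v) := by
  obtain ⟨i, rfl⟩ := hf
  obtain ⟨j, rfl⟩ := hg
  exact ⟨.eq i j, fun S _ _ v _ => Iff.rfl⟩

theorem Dfn.not (hP : Dfn 𝒮 P) : Dfn 𝒮 (fun v => ¬ P v) := by
  obtain ⟨φ, hφ⟩ := hP
  exact ⟨.not φ, fun S hS hT v hv => not_congr (hφ S hS hT v hv)⟩

theorem Dfn.and (hP : Dfn 𝒮 P) (hQ : Dfn 𝒮 Q) : Dfn 𝒮 (fun v => P v ∧ Q v) := by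
  obtain ⟨φ, hφ⟩ := hP
  obtain ⟨ψ, hψ⟩ := hQ
  exact ⟨.and φ ψ, fun S hS hT v hv => and_congr (hφ S hS hT v hv) (hψ S hS hT v hv)⟩

theorem Dfn.congr (hP : Dfn 𝒮 P) (hPQ : ∀ v, P v ↔ Q v) : Dfn 𝒮 Q := by
  have : P = Q := funext fun v => propext (hPQ v)
  exact this ▸ hP

theorem Dfn.or (hP : Dfn 𝒮 P) (hQ : Dfn 𝒮 Q) : Dfn 𝒮 (fun v => P v ∨ Q v) :=
  (hP.not.and hQ.not).not.congr fun v => by tauto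

theorem Dfn.imp (hP : Dfn 𝒮 P) (hQ : Dfn 𝒮 Q) : Dfn 𝒮 (fun v => P v → Q v) :=
  (hP.and hQ.not).not.congr fun v => by tauto

theorem Dfn.iff (hP : Dfn 𝒮 P) (hQ : Dfn 𝒮 Q) : Dfn 𝒮 (fun v => P v ↔ Q v) :=
  ((hP.imp hQ).and (hQ.imp hP)).congr fun v => by tauto

theorem Dfn.ex {S : Set ZFSet.{0}} {P : ZFSet.{0} → (Fin n → ZFSet.{0}) → Prop}
    (hP : Dfn {S} (fun w : Fin (n + 1) → ZFSet.{0} => P (w 0) (fun i => w i.succ))) :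
    Dfn {S} (fun v => ∃ x ∈ S, P x v) := by
  obtain ⟨φ, hφ⟩ := hP
  refine ⟨.ex φ, fun S' hS hT v hv => ?_⟩
  obtain rfl : S' = S := hS
  refine exists_congr fun x => and_congr_right fun hx => ?_
  refine (hφ S' rfl hT (Fin.cons x v) (Fin.cases hx hv)).trans ?_
  simp

theorem Dfn.bex {P : ZFSet.{0} → (Fin n → ZFSet.{0}) → Prop} (hf : IsProj f)
    (hP : Dfn 𝒮 (fun w : Fin (n + 1) → ZFSet.{0} => P (w 0) (fun i => w i.succ))) :
    Dfn 𝒮 (fun v => ∃ x ∈ f v, P x v) := by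
  obtain ⟨φ, hφ⟩ := hP
  obtain ⟨j, rfl⟩ := hf
  refine ⟨.ex (.and (.mem 0 j.succ) φ), fun S hS hT v hv => ?_⟩
  have key : ∀ x ∈ S, (Sat S φ (Fin.cons x v) ↔ P x v) := fun x hx =>
    (hφ S hS hT (Fin.cons x v) (Fin.cases hx hv)).trans (by simp)
  constructor
  · rintro ⟨x, hx, hxv, hs⟩
    exact ⟨x, by simpa [SatAB] using hxv, (key x hx).1 hs⟩
  · rintro ⟨x, hxv, hs⟩
    have hx := hT _ (hv j) _ hxv
    exact ⟨x, hx, by simpa [SatAB] using hxv, (key x hx).2 hs⟩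

theorem Dfn.ball {P : ZFSet.{0} → (Fin n → ZFSet.{0}) → Prop} (hf : IsProj f)
    (hP : Dfn 𝒮 (fun w : Fin (n + 1) → ZFSet.{0} => P (w 0) (fun i => w i.succ))) :
    Dfn 𝒮 (fun v => ∀ x ∈ f v, P x v) :=
  (Dfn.bex (P := fun x v => ¬ P x v) hf hP.not).not.congr fun v => by push Not; rfl

theorem Dfn.subset (hf : IsProj f) (hg : IsProj g) : Dfn 𝒮 (fun v => f v ⊆ g v) := by
  obtain ⟨i, rfl⟩ := hf
  obtain ⟨j, rfl⟩ := hg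
  exact Dfn.ball (f := fun v => v i) (P := fun x v => x ∈ v j) (.coord _)
    (.mem (.coord _) (.coord _))

theorem Dfn.eqEmpty (hf : IsProj f) : Dfn 𝒮 (fun v => f v = ∅) := by
  obtain ⟨i, rfl⟩ := hf
  refine (Dfn.ball (f := fun v => v i) (P := fun x v => ¬ x = x) (.coord _)
    (.not (.eq (.coord _) (.coord _)))).congr fun v => ?_
  rw [ZFSet.eq_empty]
  simp

theorem eq_doubleton_iff {x a b : ZFSet.{0}} :
    x = {a, b} ↔ a ∈ x ∧ b ∈ x ∧ ∀ y ∈ x, y = a ∨ y = b := by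
  constructor
  · rintro rfl
    simp
  · rintro ⟨ha, hb, h⟩
    ext y
    rw [mem_pair]
    refine ⟨h y, ?_⟩
    rintro (rfl | rfl) <;> assumption

theorem Dfn.doubleton (hf : IsProj f) (hg : IsProj g) (hh : IsProj h) :
    Dfn 𝒮 (fun v => f v = {g v, h v}) := by
  obtain ⟨i, rfl⟩ := hf
  obtain ⟨j, rfl⟩ := hg
  obtain ⟨k, rfl⟩ := hh
  simp only [eq_doubleton_iff]
  exact .and (.mem (.coord _) (.coord _)) (.and (.mem (.coord _) (.coord _))
    (.ball (.coord _) (.or (.eq (.coord _) (.coord _)) (.eq (.coord _) (.coord _)))))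

theorem eq_pair_iff {x a b : ZFSet.{0}} :
    x = pair a b ↔ (∃ y ∈ x, y = {a, a}) ∧ (∃ z ∈ x, z = {a, b}) ∧
      ∀ w ∈ x, w = {a, a} ∨ w = {a, b} := by
  have h : pair a b = {({a, a} : ZFSet.{0}), {a, b}} := by simp [pair]
  rw [h, eq_doubleton_iff]
  simp

theorem Dfn.pair (hf : IsProj f) (hg : IsProj g) (hh : IsProj h) :
    Dfn 𝒮 (fun v => f v = pair (g v) (h v)) := by
  obtain ⟨i, rfl⟩ := hf
  obtain ⟨j, rfl⟩ := hg
  obtain ⟨k, rfl⟩ := hh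
  simp only [eq_pair_iff]
  exact .and (.bex (.coord _) (.doubleton (.coord _) (.coord _) (.coord _)))
    (.and (.bex (.coord _) (.doubleton (.coord _) (.coord _) (.coord _)))
      (.ball (.coord _) (.or (.doubleton (.coord _) (.coord _) (.coord _))
        (.doubleton (.coord _) (.coord _) (.coord _)))))

theorem Dfn.pairMem (hf : IsProj f) (hg : IsProj g) (hh : IsProj h) :
    Dfn 𝒮 (fun v => ZFSet.pair (f v) (g v) ∈ h v) := by
  obtain ⟨i, rfl⟩ := hf
  obtain ⟨j, rfl⟩ := hg
  obtain ⟨k, rfl⟩ := hh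
  refine (Dfn.bex (f := fun v => v k) (P := fun x v => x = ZFSet.pair (v i) (v j)) (.coord _)
    (.pair (.coord _) (.coord _) (.coord _))).congr fun v => ?_
  simp

theorem Dfn.isOrd (hf : IsProj f) : Dfn 𝒮 (fun v => IsOrd (f v)) := by
  obtain ⟨i, rfl⟩ := hf
  unfold IsOrd IsTransitive
  exact .and (.ball (.coord _) (.subset (.coord _) (.coord _)))
    (.ball (.coord _) (.ball (.coord _) (.subset (.coord _) (.coord _))))

theorem isSurjF_iff {a b f : ZFSet.{0}} :
    IsSurjF a b f ↔ (∀ p ∈ f, ∃ x ∈ a, ∃ y ∈ b, p = pair x y) ∧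
      (∀ x ∈ a, ∃ y ∈ b, pair x y ∈ f ∧ ∀ y' ∈ b, pair x y' ∈ f → y' = y) ∧
      ∀ y ∈ b, ∃ x ∈ a, pair x y ∈ f := by
  unfold IsSurjF IsFunc
  have key : (f ⊆ prod a b) ↔ ∀ p ∈ f, ∃ x ∈ a, ∃ y ∈ b, p = pair x y := by
    simp [ZFSet.subset_def]
  rw [key, and_assoc]
  refine and_congr_right fun h1 => and_congr_left fun _ => forall₂_congr fun x hx => ?_
  have hb : ∀ y, pair x y ∈ f → y ∈ b := by
    intro y hy
    obtain ⟨_, _, y', hy', he⟩ := h1 _ hy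
    rw [pair_inj] at he
    exact he.2 ▸ hy'
  constructor
  · rintro ⟨y, hy, hu⟩
    exact ⟨y, hb y hy, hy, fun y' _ h => hu y' h⟩
  · rintro ⟨y, _, hy, hu⟩
    exact ⟨y, hy, fun y' h => hu y' (hb y' h) h⟩

theorem Dfn.isSurjF (hf : IsProj f) (hg : IsProj g) (hh : IsProj h) :
    Dfn 𝒮 (fun v => IsSurjF (f v) (g v) (h v)) := by
  obtain ⟨i, rfl⟩ := hf
  obtain ⟨j, rfl⟩ := hg
  obtain ⟨k, rfl⟩ := hh
  simp only [isSurjF_iff]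
  exact .and (.ball (.coord _) (.bex (.coord _) (.bex (.coord _)
      (.pair (.coord _) (.coord _) (.coord _)))))
    (.and (.ball (.coord _) (.bex (.coord _) (.and (.pairMem (.coord _) (.coord _) (.coord _))
        (.ball (.coord _) (.imp (.pairMem (.coord _) (.coord _) (.coord _))
          (.eq (.coord _) (.coord _)))))))
      (.ball (.coord _) (.bex (.coord _) (.pairMem (.coord _) (.coord _) (.coord _)))))

end Dfn

/-! ### Renaming variables -/

/-- Renaming of the free variables of a formula. -/
def Fml.rename : ∀ {n m : ℕ}, (Fin n → Fin m) → Fml n → Fml m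
  | _, _, e, .mem i j => .mem (e i) (e j)
  | _, _, e, .eq i j => .eq (e i) (e j)
  | _, _, e, .inA i => .inA (e i)
  | _, _, e, .inB i => .inB (e i)
  | _, _, e, .not φ => .not (φ.rename e)
  | _, _, e, .and φ ψ => .and (φ.rename e) (ψ.rename e)
  | _, _, e, .ex φ => .ex (φ.rename (Fin.cases 0 fun i => (e i).succ))

theorem satAB_rename (S A B : Set ZFSet.{0}) : ∀ {n m : ℕ} (e : Fin n → Fin m) (φ : Fml n)
    (v : Fin m → ZFSet.{0}), SatAB S A B (φ.rename e) v ↔ SatAB S A B φ (fun i => v (e i)) := by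
  intro n m e φ
  induction φ generalizing m with
  | mem i j => intro v; rfl
  | eq i j => intro v; rfl
  | inA i => intro v; rfl
  | inB i => intro v; rfl
  | not φ ih => intro v; exact not_congr (ih e v)
  | and φ ψ ih₁ ih₂ => intro v; exact and_congr (ih₁ e v) (ih₂ e v)
  | ex φ ih =>
    intro v
    refine exists_congr fun x => and_congr_right fun _ => ?_
    refine (ih _ _).trans ?_
    have : (fun i => (Fin.cons x v : Fin (m + 1) → ZFSet.{0})
        ((Fin.cases 0 (fun i => (e i).succ) i : Fin (m + 1)))) =
        Fin.cons x (fun i => v (e i)) := by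
      funext i
      refine Fin.cases ?_ (fun i => ?_) i <;> simp
    rw [this]

theorem Dfn.comp {𝒮 : Set (Set ZFSet.{0})} {n m : ℕ} {P : (Fin n → ZFSet.{0}) → Prop}
    (hP : Dfn 𝒮 P) (e : Fin n → Fin m) :
    Dfn 𝒮 (fun v : Fin m → ZFSet.{0} => P (fun i => v (e i))) := by
  obtain ⟨φ, hφ⟩ := hP
  exact ⟨φ.rename e, fun S hS hT v hv =>
    (satAB_rename S ∅ ∅ e φ v).trans (hφ S hS hT _ fun i => hv (e i))⟩

theorem Dfn.false {𝒮 : Set (Set ZFSet.{0})} {n : ℕ} :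
    Dfn 𝒮 (fun _ : Fin n → ZFSet.{0} => False) := by
  refine ⟨.ex (.and (.eq 0 0) (.not (.eq 0 0))), fun S hS hT v hv => ?_⟩
  simp [Sat, SatAB]

/-! ### Finite tuples coded as iterated pairs -/

/-- The code of a finite tuple. -/
def encF : ∀ {n : ℕ}, (Fin n → ZFSet.{0}) → ZFSet.{0}
  | 0, _ => ∅
  | _ + 1, v => pair (v 0) (encF fun i => v i.succ)

theorem pair_ne_empty (x y : ZFSet.{0}) : pair x y ≠ ∅ := by
  intro h
  have : ({x} : ZFSet.{0}) ∈ pair x y := by simp [pair]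
  rw [h] at this
  exact notMem_empty _ this

theorem encF_cons {n : ℕ} (x : ZFSet.{0}) (v : Fin n → ZFSet.{0}) :
    encF (Fin.cons x v : Fin (n + 1) → ZFSet.{0}) = pair x (encF v) := by
  simp [encF]

theorem rank_snd_lt (x y : ZFSet.{0}) : rank y < rank (pair x y) := by
  have h1 : y ∈ ({x, y} : ZFSet.{0}) := by simp
  have h2 : ({x, y} : ZFSet.{0}) ∈ pair x y := by simp [pair]
  exact (rank_lt_of_mem h1).trans (rank_lt_of_mem h2)

/-- `T` is the set of codes of finite tuples from `M`. -/
def IsTuples (M T : ZFSet.{0}) : Prop :=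
  (∃ u ∈ T, u = ∅) ∧ (∀ x ∈ M, ∀ v ∈ T, pair x v ∈ T) ∧
    ∀ u ∈ T, u = ∅ ∨ ∃ x ∈ M, ∃ v ∈ T, u = pair x v

theorem IsTuples.encF_mem {M T : ZFSet.{0}} (h : IsTuples M T) {n : ℕ} (v : Fin n → ZFSet.{0})
    (hv : ∀ i, v i ∈ M) : encF v ∈ T := by
  induction n with
  | zero =>
    obtain ⟨u, hu, rfl⟩ := h.1
    exact hu
  | succ n ih => exact h.2.1 _ (hv 0) _ (ih _ fun i => hv i.succ)

theorem IsTuples.exists_eq {M T : ZFSet.{0}} (h : IsTuples M T) (u : ZFSet.{0}) (hu : u ∈ T) :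
    ∃ (n : ℕ) (v : Fin n → ZFSet.{0}), (∀ i, v i ∈ M) ∧ u = encF v := by
  induction hr : u.rank using WellFoundedLT.induction generalizing u with
  | ind r ih =>
    subst hr
    rcases h.2.2 u hu with rfl | ⟨x, hx, w, hw, rfl⟩
    · exact ⟨0, Fin.elim0, fun i => i.elim0, rfl⟩
    · obtain ⟨n, v, hv, rfl⟩ := ih _ (rank_snd_lt x w) w hw rfl
      exact ⟨n + 1, Fin.cons x v, Fin.cases hx hv, (encF_cons x v).symm⟩

theorem exists_isTuples (M : ZFSet.{0}) : ∃ T, IsTuples M T := by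
  let T : ZFSet.{0} := ZFSet.range fun p : Σ n : ℕ, Fin n → M => encF fun i => (p.2 i : ZFSet.{0})
  have hT : ∀ {n : ℕ} (v : Fin n → ZFSet.{0}), (∀ i, v i ∈ M) → encF v ∈ T := fun {n} v hv =>
    ZFSet.mem_range.2 ⟨⟨n, fun i => ⟨v i, hv i⟩⟩, rfl⟩
  have hT' : ∀ u ∈ T, ∃ (n : ℕ) (v : Fin n → ZFSet.{0}), (∀ i, v i ∈ M) ∧ u = encF v := by
    intro u hu
    obtain ⟨⟨n, v⟩, rfl⟩ := ZFSet.mem_range.1 hu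
    exact ⟨n, fun i => v i, fun i => (v i).2, rfl⟩
  refine ⟨T, ⟨∅, hT (n := 0) Fin.elim0 fun i => i.elim0, rfl⟩, fun x hx v hv => ?_,
    fun u hu => ?_⟩
  · obtain ⟨n, v', hv', rfl⟩ := hT' v hv
    rw [← encF_cons]
    exact hT _ (Fin.cases hx hv')
  · obtain ⟨n, v, hv, rfl⟩ := hT' u hu
    cases n with
    | zero => exact .inl rfl
    | succ n => exact .inr ⟨v 0, hv 0, _, hT (fun i => v i.succ) fun i => hv i.succ, rfl⟩

/-! ### Families of definable relations -/

/-- `R` is the relation `x₀ ∈ x₁` on tuples. -/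
def RelMem (M T R : ZFSet.{0}) : Prop :=
  ∀ u ∈ T, u ∈ R ↔ ∃ x ∈ M, ∃ w ∈ T, ∃ y ∈ M, ∃ v ∈ T, u = pair x w ∧ w = pair y v ∧ x ∈ y

/-- `R` is the relation `x₀ = x₁` on tuples. -/
def RelEq (M T R : ZFSet.{0}) : Prop :=
  ∀ u ∈ T, u ∈ R ↔ ∃ x ∈ M, ∃ w ∈ T, ∃ y ∈ M, ∃ v ∈ T, u = pair x w ∧ w = pair y v ∧ x = y

/-- `Q` is the complement of the intersection of `R` and `R'`. -/
def RelNand (T R R' Q : ZFSet.{0}) : Prop := ∀ u ∈ T, u ∈ Q ↔ ¬ (u ∈ R ∧ u ∈ R')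

/-- `Q` is the projection of `R` along the first coordinate. -/
def RelEx (M T R Q : ZFSet.{0}) : Prop := ∀ u ∈ T, u ∈ Q ↔ ∃ x ∈ M, pair x u ∈ R

/-- `Q` is `R` with a dummy coordinate inserted at the first place. -/
def RelWeak (M T R Q : ZFSet.{0}) : Prop :=
  ∀ u ∈ T, u ∈ Q ↔ ∃ x ∈ M, ∃ v ∈ T, u = pair x v ∧ v ∈ R

/-- `Q` is `R` with a dummy coordinate inserted at the second place. -/
def RelIns (M T R Q : ZFSet.{0}) : Prop :=
  ∀ u ∈ T, u ∈ Q ↔ ∃ x ∈ M, ∃ w ∈ T, ∃ y ∈ M, ∃ v ∈ T,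
    u = pair x w ∧ w = pair y v ∧ pair x v ∈ R

/-- `Q` arises from `R` and `R'` by one of the relation-forming operations. -/
def RelOp (M T R R' Q : ZFSet.{0}) : Prop :=
  RelNand T R R' Q ∨ RelEx M T R Q ∨ RelWeak M T R Q ∨ RelIns M T R Q

/-- `D` is closed under the relation-forming operations. -/
def RelClosed (M T D : ZFSet.{0}) : Prop :=
  (∃ R ∈ D, RelMem M T R) ∧ (∃ R ∈ D, RelEq M T R) ∧
  (∀ R ∈ D, ∀ R' ∈ D, ∃ Q ∈ D, RelNand T R R' Q) ∧
  (∀ R ∈ D, ∃ Q ∈ D, RelEx M T R Q) ∧ (∀ R ∈ D, ∃ Q ∈ D, RelWeak M T R Q) ∧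
  (∀ R ∈ D, ∃ Q ∈ D, RelIns M T R Q)

/-- Every member of `D` is generated by the relation-forming operations, as witnessed by the
ranking relation `P` with ranks in `I`. -/
def RelGenerated (M T D P I : ZFSet.{0}) : Prop :=
  (∀ R ∈ D, ∃ k ∈ I, pair k R ∈ P) ∧
  ∀ k ∈ I, ∀ R ∈ D, pair k R ∈ P → RelMem M T R ∨ RelEq M T R ∨
    ∃ k' ∈ I, k' ∈ k ∧ ∃ R' ∈ D, ∃ R'' ∈ D, pair k' R' ∈ P ∧ pair k' R'' ∈ P ∧ RelOp M T R' R'' R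

section Generated

variable {M T D P I : ZFSet.{0}}

theorem IsTuples.mem_relMem_iff (hT : IsTuples M T) {R : ZFSet.{0}} (hR : RelMem M T R) {n : ℕ}
    (v : Fin (n + 2) → ZFSet.{0}) (hv : ∀ i, v i ∈ M) : encF v ∈ R ↔ v 0 ∈ v 1 := by
  rw [hR _ (hT.encF_mem v hv)]
  constructor
  · rintro ⟨x, hx, w, hw, y, hy, u, hu, h1, h2, h3⟩
    subst h2
    obtain ⟨rfl, h⟩ := pair_injective h1
    obtain ⟨rfl, -⟩ := pair_injective h
    exact h3
  · intro h
    exact ⟨_, hv 0, _, hT.encF_mem (fun i => v i.succ) fun i => hv i.succ, _, hv 1, _,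
      hT.encF_mem (fun i => v i.succ.succ) fun i => hv i.succ.succ, rfl, rfl, h⟩

theorem IsTuples.mem_relEq_iff (hT : IsTuples M T) {R : ZFSet.{0}} (hR : RelEq M T R) {n : ℕ}
    (v : Fin (n + 2) → ZFSet.{0}) (hv : ∀ i, v i ∈ M) : encF v ∈ R ↔ v 0 = v 1 := by
  rw [hR _ (hT.encF_mem v hv)]
  constructor
  · rintro ⟨x, hx, w, hw, y, hy, u, hu, h1, h2, h3⟩
    subst h2
    obtain ⟨rfl, h⟩ := pair_injective h1
    obtain ⟨rfl, -⟩ := pair_injective h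
    exact h3
  · intro h
    exact ⟨_, hv 0, _, hT.encF_mem (fun i => v i.succ) fun i => hv i.succ, _, hv 1, _,
      hT.encF_mem (fun i => v i.succ.succ) fun i => hv i.succ.succ, rfl, rfl, h⟩

theorem IsTuples.mem_relWeak_iff (hT : IsTuples M T) {R Q : ZFSet.{0}} (hQ : RelWeak M T R Q)
    {n : ℕ} (v : Fin (n + 1) → ZFSet.{0}) (hv : ∀ i, v i ∈ M) :
    encF v ∈ Q ↔ encF (fun i => v i.succ) ∈ R := by
  rw [hQ _ (hT.encF_mem v hv)]
  constructor
  · rintro ⟨x, hx, u, hu, h1, h2⟩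
    obtain ⟨-, rfl⟩ := pair_injective h1
    exact h2
  · intro h
    exact ⟨_, hv 0, _, hT.encF_mem (fun i => v i.succ) fun i => hv i.succ, rfl, h⟩

theorem IsTuples.mem_relIns_iff (hT : IsTuples M T) {R Q : ZFSet.{0}} (hQ : RelIns M T R Q)
    {n : ℕ} (v : Fin (n + 2) → ZFSet.{0}) (hv : ∀ i, v i ∈ M) :
    encF v ∈ Q ↔ pair (v 0) (encF fun i => v i.succ.succ) ∈ R := by
  rw [hQ _ (hT.encF_mem v hv)]
  constructor
  · rintro ⟨x, hx, w, hw, y, hy, u, hu, h1, h2, h3⟩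
    subst h2
    obtain ⟨rfl, h⟩ := pair_injective h1
    obtain ⟨-, rfl⟩ := pair_injective h
    exact h3
  · intro h
    exact ⟨_, hv 0, _, hT.encF_mem (fun i => v i.succ) fun i => hv i.succ, _, hv 1, _,
      hT.encF_mem (fun i => v i.succ.succ) fun i => hv i.succ.succ, rfl, rfl, h⟩

theorem not_pair_pair_of_encF_lt_two {n : ℕ} (hn : n < 2) (v : Fin n → ZFSet.{0})
    {x w y u : ZFSet.{0}} (h1 : encF v = pair x w) (h2 : w = pair y u) : False := by
  match n, hn, v with
  | 0, _, v => exact pair_ne_empty _ _ h1.symm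
  | 1, _, v => exact pair_ne_empty _ _ (h2.symm.trans (pair_injective h1).2.symm)

/-- Membership in `R` of tuples of any fixed length is definable over `M`. -/
def RelDfn (M R : ZFSet.{0}) : Prop :=
  ∀ n : ℕ, ∃ φ : Fml n, ∀ v : Fin n → ZFSet.{0}, (∀ i, v i ∈ M) →
    (encF v ∈ R ↔ Sat M.toSet φ v)

theorem relDfn_iff (hM : M.IsTransitive) {R : ZFSet.{0}} : RelDfn M R ↔
    ∀ n : ℕ, ∃ Q : (Fin n → ZFSet.{0}) → Prop, Dfn {M.toSet} Q ∧
      ∀ v, (∀ i, v i ∈ M) → (encF v ∈ R ↔ Q v) := by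
  refine forall_congr' fun n => ⟨?_, ?_⟩
  · rintro ⟨φ, hφ⟩
    refine ⟨fun v => Sat M.toSet φ v, ⟨φ, ?_⟩, hφ⟩
    rintro _ rfl _ v _
    rfl
  · rintro ⟨Q, ⟨φ, hφ⟩, hQ⟩
    refine ⟨φ, fun v hv => (hQ v hv).trans (hφ _ rfl ?_ v hv).symm⟩
    exact fun x hx y hy => hM x hx hy

theorem relDfn_of_mem (hM : M.IsTransitive) (hT : IsTuples M T) (hG : RelGenerated M T D P I)
    {R : ZFSet.{0}} (hR : R ∈ D) : RelDfn M R := by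
  obtain ⟨k, hk, hkR⟩ := hG.1 R hR
  induction k using ZFSet.inductionOn generalizing R with
  | h k ih =>
    rw [relDfn_iff hM]
    intro n
    rcases hG.2 k hk R hR hkR with h | h | ⟨k', hk', hkk, R', hR', R'', hR'', hP', hP'', h⟩
    · rcases lt_or_ge n 2 with hn | hn
      · refine ⟨_, Dfn.false, fun v hv => ?_⟩
        rw [h _ (hT.encF_mem v hv), iff_false]
        rintro ⟨x, _, w, _, y, _, u, _, h1, h2, _⟩
        exact not_pair_pair_of_encF_lt_two hn v h1 h2
      · obtain ⟨n, rfl⟩ := Nat.exists_eq_add_of_le' hn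
        exact ⟨_, Dfn.mem (.coord 0) (.coord 1), fun v hv => hT.mem_relMem_iff h v hv⟩
    · rcases lt_or_ge n 2 with hn | hn
      · refine ⟨_, Dfn.false, fun v hv => ?_⟩
        rw [h _ (hT.encF_mem v hv), iff_false]
        rintro ⟨x, _, w, _, y, _, u, _, h1, h2, _⟩
        exact not_pair_pair_of_encF_lt_two hn v h1 h2
      · obtain ⟨n, rfl⟩ := Nat.exists_eq_add_of_le' hn
        exact ⟨_, Dfn.eq (.coord 0) (.coord 1), fun v hv => hT.mem_relEq_iff h v hv⟩
    · have h' := (relDfn_iff hM).1 (ih k' hkk hR' hk' hP')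
      have h'' := (relDfn_iff hM).1 (ih k' hkk hR'' hk' hP'')
      rcases h with h | h | h | h
      · obtain ⟨Q', hQ', e'⟩ := h' n
        obtain ⟨Q'', hQ'', e''⟩ := h'' n
        refine ⟨_, (hQ'.and hQ'').not, fun v hv => ?_⟩
        rw [h _ (hT.encF_mem v hv), e' v hv, e'' v hv]
      · obtain ⟨Q', hQ', e'⟩ := h' (n + 1)
        refine ⟨fun v => ∃ x ∈ M.toSet, Q' (Fin.cons x v),
          Dfn.ex (P := fun x v => Q' (Fin.cons x v)) (hQ'.congr fun w => ?_), fun v hv => ?_⟩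
        · rw [← Fin.cons_self_tail w]
          rfl
        · rw [h _ (hT.encF_mem v hv)]
          refine exists_congr fun x => and_congr_right fun hx => ?_
          rw [← encF_cons]
          exact e' _ (Fin.cases hx hv)
      · cases n with
        | zero =>
          refine ⟨_, Dfn.false, fun v hv => ?_⟩
          rw [h _ (hT.encF_mem v hv), iff_false]
          rintro ⟨x, _, w, _, h1, _⟩
          exact pair_ne_empty _ _ h1.symm
        | succ n =>
          obtain ⟨Q', hQ', e'⟩ := h' n
          exact ⟨_, hQ'.comp Fin.succ, fun v hv =>
            (hT.mem_relWeak_iff h v hv).trans (e' _ fun i => hv i.succ)⟩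
      · rcases lt_or_ge n 2 with hn | hn
        · refine ⟨_, Dfn.false, fun v hv => ?_⟩
          rw [h _ (hT.encF_mem v hv), iff_false]
          rintro ⟨x, _, w, _, y, _, u, _, h1, h2, _⟩
          exact not_pair_pair_of_encF_lt_two hn v h1 h2
        · obtain ⟨n, rfl⟩ := Nat.exists_eq_add_of_le' hn
          obtain ⟨Q', hQ', e'⟩ := h' (n + 1)
          refine ⟨_, hQ'.comp (Fin.cons 0 fun i => i.succ.succ : Fin (n + 1) → Fin (n + 2)),
            fun v hv => ?_⟩
          rw [hT.mem_relIns_iff h v hv, ← encF_cons, ← e' _ fun i => hv _]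
          have : (Fin.cons (v 0) fun i => v i.succ.succ : Fin (n + 1) → ZFSet.{0}) =
              fun i => v ((Fin.cons 0 fun i => i.succ.succ : Fin (n + 1) → Fin (n + 2)) i) := by
            funext i
            refine Fin.cases ?_ (fun i => ?_) i <;> simp
          rw [this]

/-- The predicate `Q` on `n`-tuples is represented by a member of `D`. -/
def Rep (M D : ZFSet.{0}) {n : ℕ} (Q : (Fin n → ZFSet.{0}) → Prop) : Prop :=
  ∃ R ∈ D, ∀ v, (∀ i, v i ∈ M) → (encF v ∈ R ↔ Q v)

variable {n : ℕ} {Q Q' : (Fin n → ZFSet.{0}) → Prop}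

theorem Rep.nand (hT : IsTuples M T) (hD : RelClosed M T D) (h : Rep M D Q) (h' : Rep M D Q') :
    Rep M D (fun v => ¬ (Q v ∧ Q' v)) := by
  obtain ⟨R, hR, e⟩ := h
  obtain ⟨R', hR', e'⟩ := h'
  obtain ⟨R'', hR'', h⟩ := hD.2.2.1 R hR R' hR'
  exact ⟨R'', hR'', fun v hv => by rw [h _ (hT.encF_mem v hv), e v hv, e' v hv]⟩

theorem Rep.congr (h : Rep M D Q) (hQ : ∀ v, (∀ i, v i ∈ M) → (Q v ↔ Q' v)) : Rep M D Q' := by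
  obtain ⟨R, hR, e⟩ := h
  exact ⟨R, hR, fun v hv => (e v hv).trans (hQ v hv)⟩

theorem Rep.not (hT : IsTuples M T) (hD : RelClosed M T D) (h : Rep M D Q) :
    Rep M D (fun v => ¬ Q v) :=
  (h.nand hT hD h).congr fun v _ => by tauto

theorem Rep.and (hT : IsTuples M T) (hD : RelClosed M T D) (h : Rep M D Q) (h' : Rep M D Q') :
    Rep M D (fun v => Q v ∧ Q' v) :=
  ((h.nand hT hD h').not hT hD).congr fun v _ => by tauto

theorem Rep.ex (hT : IsTuples M T) (hD : RelClosed M T D) {Q : (Fin (n + 1) → ZFSet.{0}) → Prop}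
    (h : Rep M D Q) : Rep M D (fun v => ∃ x ∈ M, Q (Fin.cons x v)) := by
  obtain ⟨R, hR, e⟩ := h
  obtain ⟨R', hR', h⟩ := hD.2.2.2.1 R hR
  refine ⟨R', hR', fun v hv => ?_⟩
  rw [h _ (hT.encF_mem v hv)]
  refine exists_congr fun x => and_congr_right fun hx => ?_
  rw [← encF_cons]
  exact e _ (Fin.cases hx hv)

theorem Rep.weak (hT : IsTuples M T) (hD : RelClosed M T D) (h : Rep M D Q) :
    Rep M D (fun v : Fin (n + 1) → ZFSet.{0} => Q (fun i => v i.succ)) := by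
  obtain ⟨R, hR, e⟩ := h
  obtain ⟨R', hR', h⟩ := hD.2.2.2.2.1 R hR
  exact ⟨R', hR', fun v hv => (hT.mem_relWeak_iff h v hv).trans (e _ fun i => hv i.succ)⟩

theorem Rep.eq_succ (hT : IsTuples M T) (hD : RelClosed M T D) {n : ℕ} (j : Fin n) :
    Rep M D (fun v : Fin (n + 1) → ZFSet.{0} => v 0 = v j.succ) := by
  induction n with
  | zero => exact j.elim0
  | succ n ih =>
    refine Fin.cases ?_ (fun j => ?_) j
    · obtain ⟨R, hR, h⟩ := hD.2.1
      exact ⟨R, hR, fun v hv => hT.mem_relEq_iff h v hv⟩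
    · obtain ⟨R, hR, e⟩ := ih j
      obtain ⟨R', hR', h⟩ := hD.2.2.2.2.2 R hR
      refine ⟨R', hR', fun v hv => (hT.mem_relIns_iff h v hv).trans ?_⟩
      have := e (Fin.cons (v 0) fun i => v i.succ.succ) (Fin.cases (hv 0) fun i => hv i.succ.succ)
      rw [encF_cons] at this
      simpa using this

theorem Rep.subst (hT : IsTuples M T) (hD : RelClosed M T D) {r : ZFSet.{0} → ZFSet.{0} → Prop}
    (h : Rep M D (fun v : Fin (n + 2) → ZFSet.{0} => r (v 0) (v 1))) (i j : Fin n) :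
    Rep M D (fun v : Fin n → ZFSet.{0} => r (v i) (v j)) := by
  have h2 := Rep.ex hT hD (Rep.ex hT hD (h.and hT hD
    ((Rep.eq_succ hT hD i.succ).and hT hD ((Rep.eq_succ hT hD j).weak hT hD))))
  refine h2.congr fun v hv => ?_
  constructor
  · rintro ⟨y, hy, x, hx, h1, h2, h3⟩
    have h1' : r x y := by simpa using h1
    have h2' : x = v i := by simpa using h2
    have h3' : y = v j := by simpa using h3
    exact h2' ▸ h3' ▸ h1'
  · intro h
    refine ⟨v j, hv j, v i, hv i, ?_, ?_, ?_⟩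
    · simpa using h
    · simp
    · simp

theorem Rep.sat (hT : IsTuples M T) (hD : RelClosed M T D) {n : ℕ} (φ : Fml n) :
    Rep M D (fun v => Sat M.toSet φ v) := by
  have hmem : ∀ m : ℕ, Rep M D (fun v : Fin (m + 2) → ZFSet.{0} => v 0 ∈ v 1) := fun m => by
    obtain ⟨R, hR, h⟩ := hD.1
    exact ⟨R, hR, fun v hv => hT.mem_relMem_iff h v hv⟩
  have heq : ∀ m : ℕ, Rep M D (fun v : Fin (m + 2) → ZFSet.{0} => v 0 = v 1) := fun m =>
    Rep.eq_succ hT hD 0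
  induction φ with
  | mem i j => exact Rep.subst hT hD (r := fun x y => x ∈ y) (hmem _) i j
  | eq i j => exact Rep.subst hT hD (r := fun x y => x = y) (heq _) i j
  | @inA n i =>
    exact (Rep.not hT hD (Rep.subst hT hD (r := fun x y => x = y) (heq _) i i)).congr
      fun v _ => by simp [Sat, SatAB]
  | @inB n i =>
    exact (Rep.not hT hD (Rep.subst hT hD (r := fun x y => x = y) (heq _) i i)).congr
      fun v _ => by simp [Sat, SatAB]
  | not φ ih => exact ih.not hT hD
  | and φ ψ ih₁ ih₂ => exact ih₁.and hT hD ih₂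
  | ex φ ih => exact ih.ex hT hD

end Generated

/-- `R` is a set of tuples generated in at most `k` steps. -/
inductive GenStage (M T : ZFSet.{0}) : ℕ → ZFSet.{0} → Prop
  | mem {k : ℕ} {R : ZFSet.{0}} : R ⊆ T → RelMem M T R → GenStage M T k R
  | eq {k : ℕ} {R : ZFSet.{0}} : R ⊆ T → RelEq M T R → GenStage M T k R
  | op {k : ℕ} {R R' Q : ZFSet.{0}} : Q ⊆ T → GenStage M T k R → GenStage M T k R' →
      RelOp M T R R' Q → GenStage M T (k + 1) Q

theorem GenStage.subset {M T R : ZFSet.{0}} {k : ℕ} (h : GenStage M T k R) : R ⊆ T := by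
  cases h <;> assumption

theorem GenStage.mono {M T R : ZFSet.{0}} {k l : ℕ} (hkl : k ≤ l) (h : GenStage M T k R) :
    GenStage M T l R := by
  induction h generalizing l with
  | mem h1 h2 => exact .mem h1 h2
  | eq h1 h2 => exact .eq h1 h2
  | @op k R R' Q h1 _ _ h4 ih ih' =>
    obtain ⟨l, rfl⟩ : ∃ m, l = m + 1 := ⟨l - 1, by omega⟩
    exact .op h1 (ih (by omega)) (ih' (by omega)) h4

theorem natZ_mem_succ (n : ℕ) : natZ n ∈ natZ (n + 1) := by simp [natZ]

theorem exists_relGenerated (M T : ZFSet.{0}) :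
    ∃ D P I : ZFSet.{0}, RelClosed M T D ∧ RelGenerated M T D P I := by
  let D : ZFSet.{0} := ZFSet.sep (fun R => ∃ k, GenStage M T k R) (powerset T)
  let I : ZFSet.{0} := ZFSet.range natZ
  let P : ZFSet.{0} := ZFSet.sep (fun p => ∃ k R, p = pair (natZ k) R ∧ GenStage M T k R)
    (prod I D)
  have hD : ∀ {R k}, GenStage M T k R → R ∈ D := fun {R k} h =>
    ZFSet.mem_sep.2 ⟨ZFSet.mem_powerset.2 h.subset, k, h⟩
  have hI : ∀ k, natZ k ∈ I := fun k => ZFSet.mem_range.2 ⟨k, rfl⟩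
  have hP : ∀ {R k}, GenStage M T k R → pair (natZ k) R ∈ P := fun {R k} h =>
    ZFSet.mem_sep.2 ⟨pair_mem_prod.2 ⟨hI k, hD h⟩, k, R, rfl, h⟩
  have hop : ∀ R ∈ D, ∀ R' ∈ D, ∀ p : ZFSet.{0} → Prop,
      (∀ Q, (∀ u ∈ T, u ∈ Q ↔ p u) → RelOp M T R R' Q) →
      ∃ Q ∈ D, ∀ u ∈ T, u ∈ Q ↔ p u := by
    intro R hR R' hR' p h
    obtain ⟨-, k, hk⟩ := ZFSet.mem_sep.1 hR
    obtain ⟨-, k', hk'⟩ := ZFSet.mem_sep.1 hR'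
    have hQ : ∀ u ∈ T, u ∈ ZFSet.sep p T ↔ p u := fun u hu => by simp [hu]
    exact ⟨ZFSet.sep p T, hD (.op ZFSet.sep_subset (hk.mono (le_max_left k k'))
      (hk'.mono (le_max_right k k')) (h _ hQ)), hQ⟩
  refine ⟨D, P, I, ⟨?_, ?_, ?_, ?_, ?_, ?_⟩, ?_, ?_⟩
  · refine ⟨ZFSet.sep (fun u => ∃ x ∈ M, ∃ w ∈ T, ∃ y ∈ M, ∃ v ∈ T,
      u = pair x w ∧ w = pair y v ∧ x ∈ y) T, hD (k := 0) (.mem ZFSet.sep_subset ?_), ?_⟩ <;>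
    exact fun u hu => by simp [hu]
  · refine ⟨ZFSet.sep (fun u => ∃ x ∈ M, ∃ w ∈ T, ∃ y ∈ M, ∃ v ∈ T,
      u = pair x w ∧ w = pair y v ∧ x = y) T, hD (k := 0) (.eq ZFSet.sep_subset ?_), ?_⟩ <;>
    exact fun u hu => by simp [hu]
  · exact fun R hR R' hR' => hop R hR R' hR' _ fun Q h => .inl h
  · exact fun R hR => hop R hR R hR _ fun Q h => .inr (.inl h)
  · exact fun R hR => hop R hR R hR _ fun Q h => .inr (.inr (.inl h))
  · exact fun R hR => hop R hR R hR _ fun Q h => .inr (.inr (.inr h))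
  · intro R hR
    obtain ⟨-, k, hk⟩ := ZFSet.mem_sep.1 hR
    exact ⟨_, hI k, hP hk⟩
  · intro k hk R hR hkR
    obtain ⟨-, m, R₁, he, hg⟩ := ZFSet.mem_sep.1 hkR
    obtain ⟨rfl, rfl⟩ := pair_injective he
    cases hg with
    | mem _ h => exact .inl h
    | eq _ h => exact .inr (.inl h)
    | @op m R' R'' _ _ h1 h2 h3 =>
      exact .inr (.inr ⟨_, hI m, natZ_mem_succ m, R', hD h1, R'', hD h2, hP h1, hP h2, h3⟩)

/-! ### A bounded description of the constructible hierarchy -/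

/-- `K` is the definable power set of `M`, as witnessed by `I`, `T`, `D`, `P`. -/
def DefW (M K I T D P : ZFSet.{0}) : Prop :=
  IsTuples M T ∧ RelClosed M T D ∧ RelGenerated M T D P I ∧
  (∀ B ∈ K, B ⊆ M ∧ ∃ R ∈ D, ∃ v ∈ T, ∀ z ∈ M, z ∈ B ↔ pair z v ∈ R) ∧
  (∀ R ∈ D, ∀ v ∈ T, ∃ B ∈ K, B ⊆ M ∧ ∀ z ∈ M, z ∈ B ↔ pair z v ∈ R)

/-- `K` is the definable power set of `M`, as witnessed by members of `V`. -/
def DW (V M K : ZFSet.{0}) : Prop :=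
  ∃ I ∈ V, ∃ T ∈ V, ∃ D ∈ V, ∃ P ∈ V, DefW M K I T D P

/-- `H` consists of pairs `(β, L_β)`, and `f` belongs to one of these `L_β`, as witnessed by
members of `V`. -/
def LW (f H V : ZFSet.{0}) : Prop :=
  (∀ h ∈ H, ∃ β ∈ V, ∃ M ∈ V, h = pair β M ∧ IsOrd β ∧
    (∀ b ∈ β, ∃ N ∈ V, ∃ K ∈ V, pair b N ∈ H ∧ DW V N K ∧ K ⊆ M) ∧
    ∀ x ∈ M, ∃ b ∈ β, ∃ N ∈ V, ∃ K ∈ V, pair b N ∈ H ∧ DW V N K ∧ x ∈ K) ∧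
  ∃ β ∈ V, ∃ M ∈ V, pair β M ∈ H ∧ f ∈ M

section Dfn

variable {𝒮 : Set (Set ZFSet.{0})} {n : ℕ} {a b c d e g : (Fin n → ZFSet.{0}) → ZFSet.{0}}

theorem Dfn.isTuples (ha : IsProj a) (hb : IsProj b) : Dfn 𝒮 (fun v => IsTuples (a v) (b v)) := by
  obtain ⟨i, rfl⟩ := ha
  obtain ⟨j, rfl⟩ := hb
  unfold IsTuples
  exact .and (.bex (.coord _) (.eqEmpty (.coord _)))
    (.and (.ball (.coord _) (.ball (.coord _) (.pairMem (.coord _) (.coord _) (.coord _))))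
      (.ball (.coord _) (.or (.eqEmpty (.coord _)) (.bex (.coord _) (.bex (.coord _)
        (.pair (.coord _) (.coord _) (.coord _)))))))

theorem Dfn.relMem (ha : IsProj a) (hb : IsProj b) (hc : IsProj c) :
    Dfn 𝒮 (fun v => RelMem (a v) (b v) (c v)) := by
  obtain ⟨i, rfl⟩ := ha
  obtain ⟨j, rfl⟩ := hb
  obtain ⟨k, rfl⟩ := hc
  unfold RelMem
  exact .ball (.coord _) (.iff (.mem (.coord _) (.coord _)) (.bex (.coord _) (.bex (.coord _)
    (.bex (.coord _) (.bex (.coord _) (.and (.pair (.coord _) (.coord _) (.coord _))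
      (.and (.pair (.coord _) (.coord _) (.coord _)) (.mem (.coord _) (.coord _)))))))))

theorem Dfn.relEq (ha : IsProj a) (hb : IsProj b) (hc : IsProj c) :
    Dfn 𝒮 (fun v => RelEq (a v) (b v) (c v)) := by
  obtain ⟨i, rfl⟩ := ha
  obtain ⟨j, rfl⟩ := hb
  obtain ⟨k, rfl⟩ := hc
  unfold RelEq
  exact .ball (.coord _) (.iff (.mem (.coord _) (.coord _)) (.bex (.coord _) (.bex (.coord _)
    (.bex (.coord _) (.bex (.coord _) (.and (.pair (.coord _) (.coord _) (.coord _))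
      (.and (.pair (.coord _) (.coord _) (.coord _)) (.eq (.coord _) (.coord _)))))))))

theorem Dfn.relNand (ha : IsProj a) (hb : IsProj b) (hc : IsProj c) (hd : IsProj d) :
    Dfn 𝒮 (fun v => RelNand (a v) (b v) (c v) (d v)) := by
  obtain ⟨i, rfl⟩ := ha
  obtain ⟨j, rfl⟩ := hb
  obtain ⟨k, rfl⟩ := hc
  obtain ⟨l, rfl⟩ := hd
  unfold RelNand
  exact .ball (.coord _) (.iff (.mem (.coord _) (.coord _))
    (.not (.and (.mem (.coord _) (.coord _)) (.mem (.coord _) (.coord _)))))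

theorem Dfn.relEx (ha : IsProj a) (hb : IsProj b) (hc : IsProj c) (hd : IsProj d) :
    Dfn 𝒮 (fun v => RelEx (a v) (b v) (c v) (d v)) := by
  obtain ⟨i, rfl⟩ := ha
  obtain ⟨j, rfl⟩ := hb
  obtain ⟨k, rfl⟩ := hc
  obtain ⟨l, rfl⟩ := hd
  unfold RelEx
  exact .ball (.coord _) (.iff (.mem (.coord _) (.coord _)) (.bex (.coord _)
    (.pairMem (.coord _) (.coord _) (.coord _))))

theorem Dfn.relWeak (ha : IsProj a) (hb : IsProj b) (hc : IsProj c) (hd : IsProj d) :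
    Dfn 𝒮 (fun v => RelWeak (a v) (b v) (c v) (d v)) := by
  obtain ⟨i, rfl⟩ := ha
  obtain ⟨j, rfl⟩ := hb
  obtain ⟨k, rfl⟩ := hc
  obtain ⟨l, rfl⟩ := hd
  unfold RelWeak
  exact .ball (.coord _) (.iff (.mem (.coord _) (.coord _)) (.bex (.coord _) (.bex (.coord _)
    (.and (.pair (.coord _) (.coord _) (.coord _)) (.mem (.coord _) (.coord _))))))

theorem Dfn.relIns (ha : IsProj a) (hb : IsProj b) (hc : IsProj c) (hd : IsProj d) :
    Dfn 𝒮 (fun v => RelIns (a v) (b v) (c v) (d v)) := by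
  obtain ⟨i, rfl⟩ := ha
  obtain ⟨j, rfl⟩ := hb
  obtain ⟨k, rfl⟩ := hc
  obtain ⟨l, rfl⟩ := hd
  unfold RelIns
  exact .ball (.coord _) (.iff (.mem (.coord _) (.coord _)) (.bex (.coord _) (.bex (.coord _)
    (.bex (.coord _) (.bex (.coord _) (.and (.pair (.coord _) (.coord _) (.coord _))
      (.and (.pair (.coord _) (.coord _) (.coord _))
        (.pairMem (.coord _) (.coord _) (.coord _)))))))))

theorem Dfn.relOp (ha : IsProj a) (hb : IsProj b) (hc : IsProj c) (hd : IsProj d)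
    (he : IsProj e) : Dfn 𝒮 (fun v => RelOp (a v) (b v) (c v) (d v) (e v)) :=
  .or (.relNand hb hc hd he) (.or (.relEx ha hb hc he) (.or (.relWeak ha hb hc he)
    (.relIns ha hb hc he)))

theorem Dfn.relClosed (ha : IsProj a) (hb : IsProj b) (hc : IsProj c) :
    Dfn 𝒮 (fun v => RelClosed (a v) (b v) (c v)) := by
  obtain ⟨i, rfl⟩ := ha
  obtain ⟨j, rfl⟩ := hb
  obtain ⟨k, rfl⟩ := hc
  unfold RelClosed
  exact .and (.bex (.coord _) (.relMem (.coord _) (.coord _) (.coord _)))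
    (.and (.bex (.coord _) (.relEq (.coord _) (.coord _) (.coord _)))
    (.and (.ball (.coord _) (.ball (.coord _) (.bex (.coord _)
      (.relNand (.coord _) (.coord _) (.coord _) (.coord _)))))
    (.and (.ball (.coord _) (.bex (.coord _)
      (.relEx (.coord _) (.coord _) (.coord _) (.coord _))))
    (.and (.ball (.coord _) (.bex (.coord _)
      (.relWeak (.coord _) (.coord _) (.coord _) (.coord _))))
    (.ball (.coord _) (.bex (.coord _)
      (.relIns (.coord _) (.coord _) (.coord _) (.coord _))))))))

theorem Dfn.relGenerated (ha : IsProj a) (hb : IsProj b) (hc : IsProj c) (hd : IsProj d)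
    (he : IsProj e) : Dfn 𝒮 (fun v => RelGenerated (a v) (b v) (c v) (d v) (e v)) := by
  obtain ⟨i, rfl⟩ := ha
  obtain ⟨j, rfl⟩ := hb
  obtain ⟨k, rfl⟩ := hc
  obtain ⟨l, rfl⟩ := hd
  obtain ⟨m, rfl⟩ := he
  unfold RelGenerated
  exact .and (.ball (.coord _) (.bex (.coord _) (.pairMem (.coord _) (.coord _) (.coord _))))
    (.ball (.coord _) (.ball (.coord _) (.imp (.pairMem (.coord _) (.coord _) (.coord _))
      (.or (.relMem (.coord _) (.coord _) (.coord _))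
      (.or (.relEq (.coord _) (.coord _) (.coord _))
      (.bex (.coord _) (.and (.mem (.coord _) (.coord _)) (.bex (.coord _) (.bex (.coord _)
        (.and (.pairMem (.coord _) (.coord _) (.coord _))
        (.and (.pairMem (.coord _) (.coord _) (.coord _))
          (.relOp (.coord _) (.coord _) (.coord _) (.coord _) (.coord _)))))))))))))

theorem Dfn.defW {k : (Fin n → ZFSet.{0}) → ZFSet.{0}} (ha : IsProj a) (hb : IsProj b)
    (hc : IsProj c) (hd : IsProj d) (he : IsProj e) (hk : IsProj k) :
    Dfn 𝒮 (fun v => DefW (a v) (b v) (c v) (d v) (e v) (k v)) := by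
  obtain ⟨i, rfl⟩ := ha
  obtain ⟨j, rfl⟩ := hb
  obtain ⟨k, rfl⟩ := hc
  obtain ⟨l, rfl⟩ := hd
  obtain ⟨m, rfl⟩ := he
  obtain ⟨o, rfl⟩ := hk
  unfold DefW
  exact .and (.isTuples (.coord _) (.coord _))
    (.and (.relClosed (.coord _) (.coord _) (.coord _))
    (.and (.relGenerated (.coord _) (.coord _) (.coord _) (.coord _) (.coord _))
    (.and (.ball (.coord _) (.and (.subset (.coord _) (.coord _)) (.bex (.coord _) (.bex (.coord _)
      (.ball (.coord _) (.iff (.mem (.coord _) (.coord _))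
        (.pairMem (.coord _) (.coord _) (.coord _))))))))
    (.ball (.coord _) (.ball (.coord _) (.bex (.coord _) (.and (.subset (.coord _) (.coord _))
      (.ball (.coord _) (.iff (.mem (.coord _) (.coord _))
        (.pairMem (.coord _) (.coord _) (.coord _)))))))))))

theorem Dfn.dW (ha : IsProj a) (hb : IsProj b) (hc : IsProj c) :
    Dfn 𝒮 (fun v => DW (a v) (b v) (c v)) := by
  obtain ⟨i, rfl⟩ := ha
  obtain ⟨j, rfl⟩ := hb
  obtain ⟨k, rfl⟩ := hc
  unfold DW
  exact .bex (.coord _) (.bex (.coord _) (.bex (.coord _) (.bex (.coord _)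
    (.defW (.coord _) (.coord _) (.coord _) (.coord _) (.coord _) (.coord _)))))

theorem Dfn.lW (ha : IsProj a) (hb : IsProj b) (hc : IsProj c) :
    Dfn 𝒮 (fun v => LW (a v) (b v) (c v)) := by
  obtain ⟨i, rfl⟩ := ha
  obtain ⟨j, rfl⟩ := hb
  obtain ⟨k, rfl⟩ := hc
  unfold LW
  exact .and (.ball (.coord _) (.bex (.coord _) (.bex (.coord _)
    (.and (.pair (.coord _) (.coord _) (.coord _)) (.and (.isOrd (.coord _))
    (.and (.ball (.coord _) (.bex (.coord _) (.bex (.coord _)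
      (.and (.pairMem (.coord _) (.coord _) (.coord _))
        (.and (.dW (.coord _) (.coord _) (.coord _)) (.subset (.coord _) (.coord _)))))))
    (.ball (.coord _) (.bex (.coord _) (.bex (.coord _) (.bex (.coord _)
      (.and (.pairMem (.coord _) (.coord _) (.coord _))
        (.and (.dW (.coord _) (.coord _) (.coord _)) (.mem (.coord _) (.coord _))))))))))))))
    (.bex (.coord _) (.bex (.coord _) (.and (.pairMem (.coord _) (.coord _) (.coord _))
      (.mem (.coord _) (.coord _)))))

end Dfn

/-! ### The constructible hierarchy -/

theorem mem_defSet {M B : ZFSet.{0}} : B ∈ DefSetA ∅ M ↔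
    ∃ (n : ℕ) (φ : Fml (n + 1)) (v : Fin n → ZFSet.{0}), (∀ i, v i ∈ M) ∧
      B = ZFSet.sep (fun z => Sat M.toSet φ (Fin.cons z v)) M := by
  unfold DefSetA
  rw [ZFSet.mem_sep]
  refine ⟨fun h => h.2, fun h => ⟨?_, h⟩⟩
  obtain ⟨n, φ, v, hv, rfl⟩ := h
  exact ZFSet.mem_powerset.2 ZFSet.sep_subset

theorem subset_of_mem_defSet {M B : ZFSet.{0}} (h : B ∈ DefSetA ∅ M) : B ⊆ M := by
  obtain ⟨n, φ, v, hv, rfl⟩ := mem_defSet.1 h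
  exact ZFSet.sep_subset

/-- A definable predicate with parameters in `M` defines a member of the definable power set. -/
theorem sep_mem_defSet {M : ZFSet.{0}} (hM : M.IsTransitive) {n : ℕ}
    {Q : (Fin (n + 1) → ZFSet.{0}) → Prop} (hQ : Dfn {M.toSet} Q) (v : Fin n → ZFSet.{0})
    (hv : ∀ i, v i ∈ M) : ZFSet.sep (fun z => Q (Fin.cons z v)) M ∈ DefSetA ∅ M := by
  obtain ⟨φ, hφ⟩ := hQ
  refine mem_defSet.2 ⟨n, φ, v, hv, ?_⟩
  ext z
  simp only [ZFSet.mem_sep]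
  refine and_congr_right fun hz => ?_
  exact (hφ _ rfl (fun x hx y hy => hM x hx hy) (Fin.cons z v) (Fin.cases hz hv)).symm

theorem DefW.eq {M K I T D P : ZFSet.{0}} (hM : M.IsTransitive) (h : DefW M K I T D P) :
    K = DefSetA ∅ M := by
  obtain ⟨hT, hD, hG, h1, h2⟩ := h
  ext B
  constructor
  · intro hB
    obtain ⟨hBM, R, hR, v, hv, e⟩ := h1 B hB
    obtain ⟨n, v, hvM, rfl⟩ := hT.exists_eq v hv
    obtain ⟨φ, hφ⟩ := relDfn_of_mem hM hT hG hR (n + 1)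
    refine mem_defSet.2 ⟨n, φ, v, hvM, ?_⟩
    ext z
    rw [ZFSet.mem_sep]
    refine ⟨fun hz => ⟨hBM hz, ?_⟩, fun hz => ?_⟩
    · rw [← hφ _ (Fin.cases (hBM hz) hvM), encF_cons]
      exact (e z (hBM hz)).1 hz
    · rw [e z hz.1, ← encF_cons, hφ _ (Fin.cases hz.1 hvM)]
      exact hz.2
  · intro hB
    obtain ⟨n, φ, v, hv, rfl⟩ := mem_defSet.1 hB
    obtain ⟨R, hR, e⟩ := Rep.sat hT hD φ
    obtain ⟨B, hB, hBM, e'⟩ := h2 R hR _ (hT.encF_mem v hv)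
    convert hB using 1
    ext z
    rw [ZFSet.mem_sep]
    refine ⟨fun hz => ?_, fun hz => ⟨hBM hz, ?_⟩⟩
    · rw [e' z hz.1, ← encF_cons, e _ (Fin.cases hz.1 hv)]
      exact hz.2
    · refine (e _ (Fin.cases (hBM hz) hv)).1 ?_
      rw [encF_cons]
      exact (e' z (hBM hz)).1 hz

theorem exists_defW {M : ZFSet.{0}} (hM : M.IsTransitive) :
    ∃ I T D P : ZFSet.{0}, DefW M (DefSetA ∅ M) I T D P := by
  obtain ⟨T, hT⟩ := exists_isTuples M
  obtain ⟨D, P, I, hD, hG⟩ := exists_relGenerated M T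
  refine ⟨I, T, D, P, hT, hD, hG, fun B hB => ⟨subset_of_mem_defSet hB, ?_⟩, fun R hR v hv => ?_⟩
  · obtain ⟨n, φ, v, hv, rfl⟩ := mem_defSet.1 hB
    obtain ⟨R, hR, e⟩ := Rep.sat hT hD φ
    refine ⟨R, hR, _, hT.encF_mem v hv, fun z hz => ?_⟩
    rw [ZFSet.mem_sep, ← encF_cons, e _ (Fin.cases hz hv)]
    exact and_iff_right hz
  · obtain ⟨n, v, hvM, rfl⟩ := hT.exists_eq v hv
    obtain ⟨φ, hφ⟩ := relDfn_of_mem hM hT hG hR (n + 1)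
    refine ⟨_, mem_defSet.2 ⟨n, φ, v, hvM, rfl⟩, ZFSet.sep_subset, fun z hz => ?_⟩
    rw [ZFSet.mem_sep, ← encF_cons, hφ _ (Fin.cases hz hvM)]
    exact and_iff_right hz

theorem mem_Lstage {α x : ZFSet.{0}} :
    x ∈ Lstage α ↔ ∃ β ∈ α, x ∈ DefSetA ∅ (Lstage β) := by
  have h : Lstage α = ZFSet.sUnion (img (fun β => if β ∈ α then DefSetA ∅ (Lstage β) else ∅) α) := by
    unfold Lstage
    conv_lhs => unfold LstageA
    rw [WellFounded.fix_eq]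
    simp only [dite_eq_ite]
    rfl
  rw [h, ZFSet.mem_sUnion]
  constructor
  · rintro ⟨z, hz, hx⟩
    obtain ⟨β, hβ, rfl⟩ := mem_img.1 hz
    rw [if_pos hβ] at hx
    exact ⟨β, hβ, hx⟩
  · rintro ⟨β, hβ, hx⟩
    exact ⟨_, mem_img.2 ⟨β, hβ, rfl⟩, by rwa [if_pos hβ]⟩

theorem IsOrd.mem {α β : ZFSet.{0}} (h : IsOrd α) (hβ : β ∈ α) : IsOrd β :=
  ⟨h.2 β hβ, fun y hy => h.2 y (h.1 β hβ hy)⟩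

theorem Lstage_mono {α β : ZFSet.{0}} (h : α ⊆ β) : Lstage α ⊆ Lstage β := by
  intro x hx
  obtain ⟨γ, hγ, hx⟩ := mem_Lstage.1 hx
  exact mem_Lstage.2 ⟨γ, h hγ, hx⟩

theorem mem_defSet_of_mem {M x : ZFSet.{0}} (hM : M.IsTransitive) (hx : x ∈ M) :
    x ∈ DefSetA ∅ M := by
  have := sep_mem_defSet hM (Q := fun v : Fin 2 → ZFSet.{0} => v 0 ∈ v 1)
    (.mem (.coord _) (.coord _)) (fun _ => x) fun _ => hx
  convert this using 1
  ext z
  rw [ZFSet.mem_sep]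
  exact ⟨fun h => ⟨hM x hx h, h⟩, fun h => h.2⟩

theorem Lstage_isTransitive {α : ZFSet.{0}} (hα : IsOrd α) : (Lstage α).IsTransitive := by
  induction α using ZFSet.inductionOn with
  | h α ih =>
    intro x hx y hy
    obtain ⟨β, hβ, hx⟩ := mem_Lstage.1 hx
    exact mem_Lstage.2 ⟨β, hβ, mem_defSet_of_mem (ih β hβ (hα.mem hβ))
      (subset_of_mem_defSet hx hy)⟩

theorem LW.eq_Lstage {f H V : ZFSet.{0}} (h : LW f H V) (β M : ZFSet.{0}) (hβ : pair β M ∈ H) :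
    IsOrd β ∧ M = Lstage β := by
  induction β using ZFSet.inductionOn generalizing M with
  | h β ih =>
    obtain ⟨β', -, M', -, e, hO, h1, h2⟩ := h.1 _ hβ
    obtain ⟨rfl, rfl⟩ := pair_injective e
    refine ⟨hO, ?_⟩
    have key : ∀ b ∈ β, ∀ N K, pair b N ∈ H → DW V N K → K = DefSetA ∅ (Lstage b) := by
      rintro b hb N K hN ⟨I, -, T, -, D, -, P, -, hW⟩
      obtain ⟨hb', rfl⟩ := ih b hb N hN
      exact hW.eq (Lstage_isTransitive hb')
    ext x
    rw [mem_Lstage]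
    constructor
    · intro hx
      obtain ⟨b, hb, N, _, K, _, hN, hK, hx⟩ := h2 x hx
      exact ⟨b, hb, key b hb N K hN hK ▸ hx⟩
    · rintro ⟨b, hb, hx⟩
      obtain ⟨N, _, K, _, hN, hK, hM⟩ := h1 b hb
      exact hM ((key b hb N K hN hK).symm ▸ hx)

theorem LW.mem_LClass {f H V : ZFSet.{0}} (h : LW f H V) : f ∈ LClass := by
  obtain ⟨β, -, M, -, hβ, hf⟩ := h.2
  obtain ⟨hO, rfl⟩ := h.eq_Lstage β M hβ
  exact ⟨β, hO, hf⟩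

theorem IsOrd.succ {α : ZFSet.{0}} (h : IsOrd α) : IsOrd (insert α α) := by
  refine ⟨fun y hy z hz => ?_, fun y hy => ?_⟩
  · rcases ZFSet.mem_insert_iff.1 hy with rfl | hy
    · exact ZFSet.mem_insert_of_mem _ hz
    · exact ZFSet.mem_insert_of_mem _ (h.1 y hy hz)
  · rcases ZFSet.mem_insert_iff.1 hy with rfl | hy
    · exact h.1
    · exact h.2 y hy

theorem exists_LW {f : ZFSet.{0}} (hf : f ∈ LClass) : ∃ H V, LW f H V := by
  obtain ⟨α, hα, hf⟩ := hf
  let J := insert α α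
  have hJ : IsOrd J := hα.succ
  have hW : ∀ b : J, ∃ I T D P : ZFSet.{0}, DefW (Lstage b) (DefSetA ∅ (Lstage b)) I T D P :=
    fun b => exists_defW (Lstage_isTransitive (hJ.mem b.2))
  choose I T D P hW using hW
  let V : ZFSet.{0} := ZFSet.range fun p : J × Fin 7 =>
    (![(p.1 : ZFSet.{0}), Lstage p.1, DefSetA ∅ (Lstage p.1), I p.1, T p.1, D p.1, P p.1] :
      Fin 7 → ZFSet.{0}) p.2
  have hV : ∀ (b : J) (i : Fin 7),
      (![(b : ZFSet.{0}), Lstage b, DefSetA ∅ (Lstage b), I b, T b, D b, P b] :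
        Fin 7 → ZFSet.{0}) i ∈ V := fun b i => ZFSet.mem_range.2 ⟨(b, i), rfl⟩
  let H : ZFSet.{0} := ZFSet.range fun b : J => pair b (Lstage b)
  have hH : ∀ b : J, pair (b : ZFSet.{0}) (Lstage b) ∈ H := fun b => ZFSet.mem_range.2 ⟨b, rfl⟩
  have hDW : ∀ b : J, DW V (Lstage b) (DefSetA ∅ (Lstage b)) := fun b =>
    ⟨_, hV b 3, _, hV b 4, _, hV b 5, _, hV b 6, hW b⟩
  refine ⟨H, V, fun h hh => ?_, α, hV ⟨α, ZFSet.mem_insert _ _⟩ 0, _,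
    hV ⟨α, ZFSet.mem_insert _ _⟩ 1, hH ⟨α, ZFSet.mem_insert _ _⟩, hf⟩
  obtain ⟨β, rfl⟩ := ZFSet.mem_range.1 hh
  refine ⟨_, hV β 0, _, hV β 1, rfl, hJ.mem β.2, fun b hb => ?_, fun x hx => ?_⟩
  · have hb' : b ∈ J := hJ.1 _ β.2 hb
    refine ⟨_, hV ⟨b, hb'⟩ 1, _, hV ⟨b, hb'⟩ 2, hH ⟨b, hb'⟩, hDW ⟨b, hb'⟩, fun x hx => ?_⟩
    exact mem_Lstage.2 ⟨b, hb, hx⟩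
  · obtain ⟨b, hb, hx⟩ := mem_Lstage.1 hx
    have hb' : b ∈ J := hJ.1 _ β.2 hb
    exact ⟨b, hb, _, hV ⟨b, hb'⟩ 1, _, hV ⟨b, hb'⟩ 2, hH ⟨b, hb'⟩, hDW ⟨b, hb'⟩, hx⟩

/-! ### Elementary submodels -/

theorem codeF_injective {n : ℕ} (φ ψ : Fml n) (h : codeF φ = codeF ψ) : φ = ψ := by
  induction φ with
  | mem i j => cases ψ <;> simp_all [codeF, Nat.pair_eq_pair, Fin.ext_iff]
  | eq i j => cases ψ <;> simp_all [codeF, Nat.pair_eq_pair, Fin.ext_iff]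
  | inA i => cases ψ <;> simp_all [codeF, Nat.pair_eq_pair, Fin.ext_iff]
  | inB i => cases ψ <;> simp_all [codeF, Nat.pair_eq_pair, Fin.ext_iff]
  | not φ ih =>
    cases ψ <;> simp only [codeF, Nat.pair_eq_pair] at h <;> try omega
    rw [ih _ h.2]
  | and φ φ' ih ih' =>
    cases ψ <;> simp only [codeF, Nat.pair_eq_pair] at h <;> try omega
    rw [ih _ h.2.1, ih' _ h.2.2]
  | ex φ ih =>
    cases ψ <;> simp only [codeF, Nat.pair_eq_pair] at h <;> try omega
    rw [ih _ h.2]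

instance {n : ℕ} : Countable (Fml n) :=
  Function.Injective.countable (f := codeF) fun φ ψ h => codeF_injective φ ψ h

theorem elemSub_of_tarskiVaught {X : ZFSet.{0}} {S : Set ZFSet.{0}} (hX : X.toSet ⊆ S)
    (h : ∀ {n : ℕ} (φ : Fml (n + 1)) (v : Fin n → ZFSet.{0}), (∀ i, v i ∈ X) →
      (∃ x ∈ S, Sat S φ (Fin.cons x v)) → ∃ x ∈ X, Sat S φ (Fin.cons x v)) : ElemSub X S := by
  refine ⟨hX, fun {n} φ => ?_⟩
  induction φ with
  | mem i j => exact fun v _ => Iff.rfl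
  | eq i j => exact fun v _ => Iff.rfl
  | inA i => exact fun v _ => Iff.rfl
  | inB i => exact fun v _ => Iff.rfl
  | not φ ih => exact fun v hv => not_congr (ih v hv)
  | and φ ψ ih ih' => exact fun v hv => and_congr (ih v hv) (ih' v hv)
  | ex φ ih =>
    intro v hv
    constructor
    · rintro ⟨x, hx, hs⟩
      exact ⟨x, hX hx, (ih _ (Fin.cases hx hv)).1 hs⟩
    · intro hs
      obtain ⟨x, hx, hs⟩ := h φ v hv hs
      exact ⟨x, hx, (ih _ (Fin.cases hx hv)).2 hs⟩

theorem mem_toSet_iff {x Y : ZFSet.{0}} : x ∈ Y.toSet ↔ x ∈ Y := Iff.rfl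

theorem exists_toSet_eq_of_countable {A : Set ZFSet.{0}} (hA : A.Countable) :
    ∃ Y : ZFSet.{0}, Y.toSet = A := by
  have := hA.to_subtype
  refine ⟨ZFSet.range fun a : A => (a : ZFSet.{0}), ?_⟩
  ext x
  simp [mem_toSet_iff]

/-- The downward Löwenheim–Skolem theorem for classes. -/
theorem exists_elemSub {S A : Set ZFSet.{0}} (hA : A.Countable) (hAS : A ⊆ S) (hS : S.Nonempty) :
    ∃ Y : ZFSet.{0}, A ⊆ Y.toSet ∧ Y.toSet.Countable ∧ ElemSub Y S := by
  obtain ⟨s, hs⟩ := hS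
  have hsk : ∀ {n : ℕ} (φ : Fml (n + 1)) (v : Fin n → ZFSet.{0}), ∃ y ∈ S,
      (∃ x ∈ S, Sat S φ (Fin.cons x v)) → Sat S φ (Fin.cons y v) := by
    intro n φ v
    by_cases h : ∃ x ∈ S, Sat S φ (Fin.cons x v)
    · obtain ⟨x, hx, hs⟩ := h
      exact ⟨x, hx, fun _ => hs⟩
    · exact ⟨s, hs, fun h' => absurd h' h⟩
  choose sk hskS hsk using @hsk
  let step : Set ZFSet.{0} → Set ZFSet.{0} := fun B => B ∪
    Set.range fun p : Σ n : ℕ, Fml (n + 1) × (Fin n → B) => sk p.2.1 fun i => (p.2.2 i : ZFSet.{0})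
  let C : ℕ → Set ZFSet.{0} := fun k => step^[k] A
  have hsucc : ∀ k, C (k + 1) = step (C k) := fun k => Function.iterate_succ_apply' step k A
  have hmono : Monotone C := monotone_nat_of_le_succ fun k => by
    rw [hsucc]
    exact Set.subset_union_left
  have hcount : ∀ k, (C k).Countable := fun k => by
    induction k with
    | zero => exact hA
    | succ k ih =>
      rw [hsucc]
      have := ih.to_subtype
      exact ih.union (Set.countable_range _)
  have hCS : ∀ k, C k ⊆ S := fun k => by
    induction k with
    | zero => exact hAS
    | succ k ih =>
      rw [hsucc]
      refine Set.union_subset ih ?_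
      rintro _ ⟨p, rfl⟩
      exact hskS _ _
  obtain ⟨Y, hY⟩ := exists_toSet_eq_of_countable (Set.countable_iUnion hcount)
  have hmem : ∀ x, x ∈ Y ↔ ∃ k, x ∈ C k := fun x => by
    rw [← mem_toSet_iff, hY, Set.mem_iUnion]
  refine ⟨Y, ?_, hY ▸ Set.countable_iUnion hcount, elemSub_of_tarskiVaught ?_ ?_⟩
  · rw [hY]
    exact Set.subset_iUnion C 0
  · rw [hY]
    exact Set.iUnion_subset hCS
  · intro n φ v hv hex
    choose k hk using fun i => (hmem (v i)).1 (hv i)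
    have hK : ∀ i, v i ∈ C (Finset.univ.sup k) := fun i =>
      hmono (Finset.le_sup (Finset.mem_univ i)) (hk i)
    refine ⟨sk φ v, (hmem _).2 ⟨Finset.univ.sup k + 1, ?_⟩, hsk φ v hex⟩
    rw [hsucc]
    exact .inr ⟨⟨n, φ, fun i => ⟨v i, hK i⟩⟩, rfl⟩

theorem ElemSub.exists_mem {X : ZFSet.{0}} {S : Set ZFSet.{0}} (hX : ElemSub X S) (hS : TransCl S)
    {n : ℕ} {P : ZFSet.{0} → (Fin n → ZFSet.{0}) → Prop}
    (hP : Dfn {S} (fun w : Fin (n + 1) → ZFSet.{0} => P (w 0) (fun i => w i.succ)))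
    {v : Fin n → ZFSet.{0}} (hv : ∀ i, v i ∈ X) (h : ∃ x ∈ S, P x v) : ∃ x ∈ X, P x v := by
  obtain ⟨φ, hφ⟩ := hP
  have key : ∀ x ∈ S, (Sat S φ (Fin.cons x v) ↔ P x v) := fun x hx =>
    (hφ S rfl hS (Fin.cons x v) (Fin.cases hx fun i => hX.1 (hv i))).trans (by simp)
  obtain ⟨x, hx, h⟩ := h
  obtain ⟨y, hy, h'⟩ := (hX.2 (.ex φ) v hv).2 ⟨x, hx, (key x hx).2 h⟩
  exact ⟨y, hy, (key y (hX.1 hy)).1 ((hX.2 φ _ (Fin.cases hy hv)).1 h')⟩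

/-! ### Transitive collapses -/

theorem mem_collapse {X y u : ZFSet.{0}} :
    u ∈ collapse X y ↔ ∃ z ∈ y, z ∈ X ∧ collapse X z = u := by
  have h : collapse X y =
      img (fun z => if z ∈ y then collapse X z else ∅) (ZFSet.sep (fun z => z ∈ X) y) := by
    conv_lhs => unfold collapse
    rw [WellFounded.fix_eq]
    simp only [dite_eq_ite]
    rfl
  rw [h, mem_img]
  constructor
  · rintro ⟨z, hz, rfl⟩
    rw [ZFSet.mem_sep] at hz
    exact ⟨z, hz.1, hz.2, by rw [if_pos hz.1]⟩
  · rintro ⟨z, hz, hzX, rfl⟩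
    exact ⟨z, ZFSet.mem_sep.2 ⟨hz, hzX⟩, by rw [if_pos hz]⟩

theorem mem_collapseSet {X u : ZFSet.{0}} : u ∈ collapseSet X ↔ ∃ z ∈ X, collapse X z = u :=
  mem_img

theorem collapse_mem_collapseSet {X y : ZFSet.{0}} (hy : y ∈ X) : collapse X y ∈ collapseSet X :=
  mem_collapseSet.2 ⟨y, hy, rfl⟩

theorem collapseSet_isTransitive (X : ZFSet.{0}) : (collapseSet X).IsTransitive := by
  intro u hu w hw
  obtain ⟨z, hz, rfl⟩ := mem_collapseSet.1 hu
  obtain ⟨z', hz', hX, rfl⟩ := mem_collapse.1 hw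
  exact collapse_mem_collapseSet hX

theorem collapseSet_countable {X : ZFSet.{0}} (hX : X.toSet.Countable) :
    (collapseSet X).toSet.Countable := by
  have : (collapseSet X).toSet = collapse X '' X.toSet := by
    ext u
    simp [mem_toSet_iff, mem_collapseSet]
  rw [this]
  exact hX.image _

/-- The collapse is the identity on transitive parts. -/
theorem collapse_eq_self {X A : ZFSet.{0}} (hA : A.IsTransitive) (hAX : A ⊆ X) {y : ZFSet.{0}}
    (hy : y ∈ A) : collapse X y = y := by
  induction y using ZFSet.inductionOn with
  | h y ih =>
    ext u
    rw [mem_collapse]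
    constructor
    · rintro ⟨z, hz, _, rfl⟩
      rwa [ih z hz (hA y hy hz)]
    · intro hu
      exact ⟨u, hu, hAX (hA y hy hu), ih u hu (hA y hy hu)⟩

theorem ElemSub.ext {X : ZFSet.{0}} {S : Set ZFSet.{0}} (hX : ElemSub X S) (hS : TransCl S)
    {x y : ZFSet.{0}} (hx : x ∈ X) (hy : y ∈ X) (h : ∀ z ∈ X, z ∈ x ↔ z ∈ y) : x = y := by
  by_contra hne
  have hex : ∃ z ∈ S, ¬ (z ∈ x ↔ z ∈ y) := by
    by_contra hcon
    push Not at hcon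
    refine hne (ZFSet.ext fun z => ⟨fun hz => ?_, fun hz => ?_⟩)
    · exact (hcon z (hS x (hX.1 hx) z hz)).1 hz
    · exact (hcon z (hS y (hX.1 hy) z hz)).2 hz
  obtain ⟨z, hz, hn⟩ := hX.exists_mem hS (v := ![x, y])
    (P := fun z v => ¬ (z ∈ v 0 ↔ z ∈ v 1))
    (.not (.iff (.mem (.coord _) (.coord _)) (.mem (.coord _) (.coord _))))
    (Fin.cases hx (Fin.cases hy fun i => i.elim0)) hex
  exact hn (h z hz)

theorem ElemSub.collapse_injective {X : ZFSet.{0}} {S : Set ZFSet.{0}} (hX : ElemSub X S)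
    (hS : TransCl S) {x y : ZFSet.{0}} (hx : x ∈ X) (hy : y ∈ X)
    (h : collapse X x = collapse X y) : x = y := by
  induction x using ZFSet.inductionOn generalizing y with
  | h x ih =>
    refine hX.ext hS hx hy fun z hz => ⟨fun hzx => ?_, fun hzy => ?_⟩
    · have : collapse X z ∈ collapse X y := h ▸ mem_collapse.2 ⟨z, hzx, hz, rfl⟩
      obtain ⟨w, hw, hwX, e⟩ := mem_collapse.1 this
      rwa [ih z hzx hz hwX e.symm]
    · have : collapse X z ∈ collapse X x := h ▸ mem_collapse.2 ⟨z, hzy, hz, rfl⟩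
      obtain ⟨w, hw, hwX, e⟩ := mem_collapse.1 this
      rwa [← ih w hw hwX hz e]

theorem ElemSub.sat_collapse {X : ZFSet.{0}} {S : Set ZFSet.{0}} (hX : ElemSub X S)
    (hS : TransCl S) {n : ℕ} (φ : Fml n) (v : Fin n → ZFSet.{0}) (hv : ∀ i, v i ∈ X) :
    Sat X.toSet φ v ↔ Sat (collapseSet X).toSet φ fun i => collapse X (v i) := by
  induction φ with
  | mem i j =>
    refine ⟨fun h => mem_collapse.2 ⟨_, h, hv i, rfl⟩, fun h => ?_⟩
    obtain ⟨z, hz, hzX, e⟩ := mem_collapse.1 h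
    have hzv : z = v i := hX.collapse_injective hS hzX (hv i) e
    exact (hzv ▸ hz : v i ∈ v j)
  | eq i j =>
    exact ⟨fun h => congrArg (collapse X) h, fun h => hX.collapse_injective hS (hv i) (hv j) h⟩
  | inA i => exact Iff.rfl
  | inB i => exact Iff.rfl
  | not φ ih => exact not_congr (ih v hv)
  | and φ ψ ih ih' => exact and_congr (ih v hv) (ih' v hv)
  | ex φ ih =>
    have key : ∀ x, (fun i => collapse X ((Fin.cons x v : Fin _ → ZFSet.{0}) i)) =
        Fin.cons (collapse X x) fun i => collapse X (v i) := by
      intro x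
      funext i
      refine Fin.cases ?_ (fun i => ?_) i <;> simp
    constructor
    · rintro ⟨x, hx, h⟩
      have := (ih _ (Fin.cases hx hv)).1 h
      rw [key] at this
      exact ⟨_, collapse_mem_collapseSet hx, this⟩
    · rintro ⟨y, hy, h⟩
      obtain ⟨x, hx, rfl⟩ := mem_collapseSet.1 hy
      refine ⟨x, hx, (ih _ (Fin.cases hx hv)).2 ?_⟩
      rw [key]
      exact h

/-- A constructible set with countable transitive closure has a countable witness. -/
theorem exists_countable_LW {f A : ZFSet.{0}} (hf : f ∈ LClass) (hA : A.IsTransitive)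
    (hc : A.toSet.Countable) (hfA : f ∈ A) : ∃ N H V : ZFSet.{0}, N.IsTransitive ∧
      N.toSet.Countable ∧ f ∈ N ∧ H ∈ N ∧ V ∈ N ∧ LW f H V := by
  obtain ⟨H, V, h⟩ := exists_LW hf
  obtain ⟨Y, hAY, hY, hE⟩ := exists_elemSub (S := Set.univ) (A := insert H (insert V A.toSet))
    ((hc.insert V).insert H) (Set.subset_univ _) ⟨∅, trivial⟩
  have hS : TransCl (Set.univ : Set ZFSet.{0}) := fun _ _ _ _ => trivial
  obtain ⟨φ, hφ⟩ : Dfn Set.univ fun v : Fin 3 → ZFSet.{0} => LW (v 0) (v 1) (v 2) :=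
    .lW (.coord _) (.coord _) (.coord _)
  have hHY : H ∈ Y := hAY (.inl rfl)
  have hVY : V ∈ Y := hAY (.inr (.inl rfl))
  have hAY' : A ⊆ Y := fun x hx => hAY (.inr (.inr hx))
  have hv : ∀ i, (![f, H, V] : Fin 3 → ZFSet.{0}) i ∈ Y :=
    Fin.cases (hAY' hfA) (Fin.cases hHY (Fin.cases hVY fun i => i.elim0))
  have hN := collapseSet_isTransitive Y
  have h1 := (hφ Set.univ trivial hS ![f, H, V] fun _ => trivial).2 h
  rw [← hE.2 φ _ hv, hE.sat_collapse hS φ _ hv] at h1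
  have h2 : LW (collapse Y f) (collapse Y H) (collapse Y V) :=
    (hφ (collapseSet Y).toSet trivial (fun x hx y hy => hN x hx hy) _
      fun i => collapse_mem_collapseSet (hv i)).1 h1
  have hff : collapse Y f = f := collapse_eq_self hA hAY' hfA
  rw [hff] at h2
  exact ⟨_, _, _, hN, collapseSet_countable hY, hff ▸ collapse_mem_collapseSet (hAY' hfA),
    collapse_mem_collapseSet hHY, collapse_mem_collapseSet hVY, h2⟩

/-! ### Ordinals and cardinals -/

theorem isOrd_iff {x : ZFSet.{0}} : IsOrd x ↔ x.IsOrdinal :=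
  ZFSet.isOrdinal_iff_forall_mem_isTransitive.symm

theorem isOrd_toZFSet (o : Ordinal.{0}) : IsOrd o.toZFSet := isOrd_iff.2 (isOrdinal_toZFSet o)

theorem IsOrd.exists_eq {x : ZFSet.{0}} (h : IsOrd x) : ∃ o : Ordinal.{0}, o.toZFSet = x :=
  ⟨_, (isOrd_iff.1 h).toZFSet_rank_eq⟩

theorem eqNum_iff {x y : ZFSet.{0}} : EqNum x y ↔ x.card = y.card := by
  rw [← Cardinal.lift_inj.{0, 1}, ← cardinalMk_coe_sort, ← cardinalMk_coe_sort, Cardinal.eq]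
  rfl

theorem cardLE_iff {x y : ZFSet.{0}} : CardLE x y ↔ x.card ≤ y.card := by
  rw [← Cardinal.lift_le.{1, 0}, ← cardinalMk_coe_sort, ← cardinalMk_coe_sort, Cardinal.le_def]
  rfl

theorem countable_iff {x : ZFSet.{0}} : x.toSet.Countable ↔ x.card ≤ Cardinal.aleph0 := by
  rw [← Cardinal.lift_le.{1, 0}, ← cardinalMk_coe_sort, Cardinal.lift_aleph0]
  exact Cardinal.mk_le_aleph0_iff.symm

theorem natZ_eq_toZFSet (n : ℕ) : natZ n = (n : Ordinal.{0}).toZFSet := by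
  induction n with
  | zero => simp [natZ]
  | succ n ih => rw [natZ, ih, Nat.cast_succ, Ordinal.toZFSet_add_one]

theorem mem_omega_iff {x : ZFSet.{0}} : x ∈ omega ↔ ∃ n, natZ n = x := by
  constructor
  · intro h
    induction x using ZFSet.inductionOn with
    | _ x ih =>
    have : x = ∅ ∨ ∃ y ∈ omega, x = insert y y := by
      induction x using Quotient.inductionOn with
      | _ a =>
      obtain ⟨⟨n⟩, hn⟩ := h
      rcases n with _ | n
      · exact .inl (Quotient.sound hn)
      · exact .inr ⟨ZFSet.mk (PSet.ofNat n), ⟨⟨n⟩, PSet.Equiv.refl _⟩, Quotient.sound hn⟩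
    rcases this with rfl | ⟨y, hy, rfl⟩
    · exact ⟨0, rfl⟩
    · obtain ⟨n, rfl⟩ := ih y (mem_insert _ _) hy
      exact ⟨n + 1, rfl⟩
  · rintro ⟨n, rfl⟩
    induction n with
    | zero => exact omega_zero
    | succ n ih => exact omega_succ ih

theorem omega_eq : ZFSet.omega = (Ordinal.omega0 : Ordinal.{0}).toZFSet := by
  ext x
  rw [mem_omega_iff, Ordinal.mem_toZFSet_iff]
  constructor
  · rintro ⟨n, rfl⟩
    exact ⟨n, Ordinal.natCast_lt_omega0 n, (natZ_eq_toZFSet n).symm⟩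
  · rintro ⟨a, ha, rfl⟩
    obtain ⟨n, rfl⟩ := Ordinal.lt_omega0.1 ha
    exact ⟨n, natZ_eq_toZFSet n⟩

theorem isCard_toZFSet {o : Ordinal.{0}} : IsCard o.toZFSet ↔ ∀ a < o, a.card ≠ o.card := by
  unfold IsCard
  simp only [isOrd_toZFSet, true_and, eqNum_iff]
  constructor
  · intro h a ha
    simpa using h _ (Ordinal.toZFSet_mem_toZFSet_iff.2 ha)
  · intro h x hx
    obtain ⟨a, ha, rfl⟩ := Ordinal.mem_toZFSet_iff.1 hx
    simpa using h a ha

theorem leastOrd_eq {p : ZFSet.{0} → Prop} {o : Ordinal.{0}} (ho : p o.toZFSet)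
    (h : ∀ a < o, ¬ p a.toZFSet) : leastOrd p = o.toZFSet := by
  have hex : ∃ α, (IsOrd α ∧ p α) ∧ ∀ β ∈ α, ¬ (IsOrd β ∧ p β) := by
    refine ⟨o.toZFSet, ⟨isOrd_toZFSet o, ho⟩, fun β hβ hp => ?_⟩
    obtain ⟨a, ha, rfl⟩ := Ordinal.mem_toZFSet_iff.1 hβ
    exact h a ha hp.2
  unfold leastOrd
  rw [dif_pos hex]
  obtain ⟨⟨h1, h2⟩, h3⟩ := hex.choose_spec
  obtain ⟨b, hb⟩ := h1.exists_eq
  rw [← hb] at h2 h3 ⊢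
  rcases lt_trichotomy b o with hbo | rfl | hbo
  · exact absurd h2 (h b hbo)
  · rfl
  · exact absurd ⟨isOrd_toZFSet o, ho⟩ (h3 _ (Ordinal.toZFSet_mem_toZFSet_iff.2 hbo))

theorem aleph_one_eq : Aleph 1 = (Ordinal.omega 1 : Ordinal.{0}).toZFSet := by
  have h : Aleph 1 = leastOrd (fun κ => IsCard κ ∧ ZFSet.omega ∈ κ) := rfl
  rw [h, omega_eq]
  have hc : (Ordinal.omega 1 : Ordinal.{0}).card = Cardinal.aleph 1 := Ordinal.card_omega 1
  refine leastOrd_eq ⟨isCard_toZFSet.2 fun a ha => ?_,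
    Ordinal.toZFSet_mem_toZFSet_iff.2 Ordinal.omega0_lt_omega_one⟩ ?_
  · rw [hc]
    rw [← Cardinal.ord_aleph, Cardinal.lt_ord] at ha
    exact ha.ne
  · rintro a ha ⟨h1, h2⟩
    rw [Ordinal.toZFSet_mem_toZFSet_iff] at h2
    rw [← Cardinal.ord_aleph, Cardinal.lt_ord, ← Cardinal.succ_aleph0, Order.lt_succ_iff] at ha
    refine isCard_toZFSet.1 h1 _ h2 (le_antisymm (Ordinal.card_le_card h2.le) ?_)
    simpa using ha

theorem mem_aleph_one_iff {x : ZFSet.{0}} : x ∈ Aleph 1 ↔ IsOrd x ∧ x.toSet.Countable := by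
  rw [aleph_one_eq, Ordinal.mem_toZFSet_iff]
  have key : ∀ a : Ordinal.{0}, a < Ordinal.omega 1 ↔ a.toZFSet.toSet.Countable := by
    intro a
    rw [countable_iff, Ordinal.card_toZFSet, ← Cardinal.ord_aleph, Cardinal.lt_ord,
      ← Cardinal.succ_aleph0, Order.lt_succ_iff]
  constructor
  · rintro ⟨a, ha, rfl⟩
    exact ⟨isOrd_toZFSet a, (key a).1 ha⟩
  · rintro ⟨h1, h2⟩
    obtain ⟨a, rfl⟩ := h1.exists_eq
    exact ⟨a, (key a).2 h2, rfl⟩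

theorem isOrd_aleph_one : IsOrd (Aleph 1) := aleph_one_eq ▸ isOrd_toZFSet _

theorem not_countable_aleph_one : ¬ (Aleph 1).toSet.Countable := fun h =>
  mem_irrefl _ (mem_aleph_one_iff.2 ⟨isOrd_aleph_one, h⟩)

theorem omega_mem_aleph_one : ZFSet.omega ∈ Aleph 1 := by
  rw [aleph_one_eq, omega_eq]
  exact Ordinal.toZFSet_mem_toZFSet_iff.2 Ordinal.omega0_lt_omega_one

theorem exists_isRegular : ∃ κ, IsRegular κ ∧ Aleph 1 ∈ κ := by
  refine ⟨(Ordinal.omega 2 : Ordinal.{0}).toZFSet, ⟨isCard_toZFSet.2 fun a ha => ?_, ?_⟩, ?_⟩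
  · rw [Ordinal.card_omega]
    rw [← Cardinal.ord_aleph, Cardinal.lt_ord] at ha
    exact ha.ne
  · intro x hx hu
    rw [eqNum_iff]
    refine le_antisymm (card_mono hx) ?_
    by_contra! hlt
    rw [Ordinal.card_toZFSet, Ordinal.card_omega] at hlt
    have hreg : (Cardinal.aleph 2 : Cardinal.{0}).IsRegular := by
      have := Cardinal.isRegular_aleph_add_one (o := (1 : Ordinal.{0}))
      rwa [one_add_one_eq_two] at this
    have h1 : (⨆ i : Shrink.{0} x, (rank ((equivShrink x).symm i).1 + 1)) <
        (Cardinal.aleph 2 : Cardinal.{0}).ord := by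
      refine Ordinal.iSup_add_one_lt_of_lt_cof (by rwa [hreg.cof_ord]) fun i => ?_
      obtain ⟨a, ha, he⟩ := Ordinal.mem_toZFSet_iff.1 (hx ((equivShrink x).symm i).2)
      rw [← he, Ordinal.rank_toZFSet, Cardinal.ord_aleph]
      exact ha
    rw [Cardinal.ord_aleph] at h1
    obtain ⟨γ, hγ, hγ'⟩ := hu _ (Ordinal.toZFSet_mem_toZFSet_iff.2 h1)
    obtain ⟨a, ha, rfl⟩ := Ordinal.mem_toZFSet_iff.1 (hx hγ)
    have h2 : a < ⨆ i : Shrink.{0} x, (rank ((equivShrink x).symm i).1 + 1) := by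
      refine lt_of_lt_of_le ?_ (le_ciSup Ordinal.bddAbove_of_small (equivShrink x ⟨_, hγ⟩))
      simp
    rw [Ordinal.toZFSet_mem_toZFSet_iff, Ordinal.toZFSet_injective.eq_iff] at hγ'
    rcases hγ' with h | h
    · exact lt_asymm h h2
    · exact h2.ne' h
  · rw [aleph_one_eq, Ordinal.toZFSet_mem_toZFSet_iff, Ordinal.omega_lt_omega]
    norm_num

/-! ### Hereditarily small sets -/

section Hset

variable {κ : ZFSet.{0}}

theorem transCl_Hset (κ : ZFSet.{0}) : TransCl (Hset κ) := by
  rintro x ⟨t, ht, hx, hc⟩ y hy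
  exact ⟨t, ht, ht x hx hy, hc⟩

theorem subset_Hset {t : ZFSet.{0}} (hκ : Aleph 1 ∈ κ) (ht : t.IsTransitive)
    (hc : t.card ≤ Cardinal.aleph 1) : t.toSet ⊆ Hset κ := by
  refine fun x hx => ⟨t, ht, hx, Aleph 1, hκ, cardLE_iff.2 ?_⟩
  rw [aleph_one_eq, Ordinal.card_toZFSet, Ordinal.card_omega]
  exact hc

theorem subset_Hset_of_countable {t : ZFSet.{0}} (hκ : Aleph 1 ∈ κ) (ht : t.IsTransitive)
    (hc : t.toSet.Countable) : t.toSet ⊆ Hset κ :=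
  subset_Hset hκ ht ((countable_iff.1 hc).trans (Cardinal.aleph0_le_aleph 1))

theorem aleph_one_mem_Hset (hκ : Aleph 1 ∈ κ) : Aleph 1 ∈ Hset κ := by
  refine subset_Hset (t := insert (Aleph 1) (Aleph 1)) hκ isOrd_aleph_one.succ.1 ?_
    (mem_insert _ _)
  refine card_insert_le.trans ?_
  rw [aleph_one_eq, Ordinal.card_toZFSet, Ordinal.card_omega,
    Cardinal.add_one_eq (Cardinal.aleph0_le_aleph 1)]

theorem exists_transitive_of_subset_prod {B f : ZFSet.{0}} (hB : B.IsTransitive)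
    (hc : B.toSet.Countable) (hf : f ⊆ prod B B) :
    ∃ A : ZFSet.{0}, A.IsTransitive ∧ A.toSet.Countable ∧ f ∈ A := by
  have hfc : f.toSet.Countable := by
    refine (hc.image2 hc pair).mono fun p hp => ?_
    obtain ⟨a, ha, b, hb, rfl⟩ := mem_prod.1 (hf hp)
    exact ⟨a, ha, b, hb, rfl⟩
  have hD : (insert f (f.toSet ∪ (Set.image2 (fun a b => ({a, b} : ZFSet.{0})) B.toSet B.toSet ∪
      B.toSet))).Countable := ((hfc.union ((hc.image2 hc _).union hc)).insert f)
  obtain ⟨A, hA⟩ := exists_toSet_eq_of_countable hD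
  have hmem : ∀ x, x ∈ A ↔ x = f ∨ x ∈ f ∨ (∃ a ∈ B, ∃ b ∈ B, {a, b} = x) ∨ x ∈ B := fun x => by
    rw [← mem_toSet_iff, hA]
    rfl
  refine ⟨A, fun x hx y hy => ?_, hA ▸ hD, (hmem f).2 (.inl rfl)⟩
  rw [hmem] at hx ⊢
  rcases hx with rfl | hx | ⟨a, ha, b, hb, rfl⟩ | hx
  · exact .inr (.inl hy)
  · obtain ⟨a, ha, b, hb, rfl⟩ := mem_prod.1 (hf hx)
    refine .inr (.inr (.inl ?_))
    rw [ZFSet.pair, mem_pair] at hy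
    rcases hy with rfl | rfl
    · exact ⟨a, ha, a, ha, by simp⟩
    · exact ⟨a, ha, b, hb, rfl⟩
  · rw [mem_pair] at hy
    rcases hy with rfl | rfl <;> simp [*]
  · exact .inr (.inr (.inr (hB x hx hy)))

theorem mem_Hset_of_subset_prod {B f : ZFSet.{0}} (hκ : Aleph 1 ∈ κ) (hB : B.IsTransitive)
    (hc : B.toSet.Countable) (hf : f ⊆ prod B B) : f ∈ Hset κ := by
  obtain ⟨A, hA, hAc, hfA⟩ := exists_transitive_of_subset_prod hB hc hf
  exact subset_Hset_of_countable hκ hA hAc hfA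

/-! ### Definability of `ω` -/

/-- `m` is the successor `n ∪ {n}`. -/
def IsSuccSet (n m : ZFSet.{0}) : Prop := n ∈ m ∧ n ⊆ m ∧ ∀ y ∈ m, y = n ∨ y ∈ n

theorem isSuccSet_iff {n m : ZFSet.{0}} : IsSuccSet n m ↔ m = insert n n := by
  constructor
  · rintro ⟨h1, h2, h3⟩
    ext y
    rw [mem_insert_iff]
    refine ⟨h3 y, ?_⟩
    rintro (rfl | h)
    · exact h1
    · exact h2 h
  · rintro rfl
    exact ⟨mem_insert _ _, fun y hy => mem_insert_of_mem _ hy, fun y hy => mem_insert_iff.1 hy⟩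

/-- A first-order description of `ω`. -/
def IsOmega (w : ZFSet.{0}) : Prop :=
  (∃ z ∈ w, z = ∅) ∧ (∀ n ∈ w, ∃ m ∈ w, IsSuccSet n m) ∧
    ∀ n ∈ w, n = ∅ ∨ ∃ k ∈ w, IsSuccSet k n

theorem isOmega_iff {w : ZFSet.{0}} : IsOmega w ↔ w = omega := by
  unfold IsOmega
  simp only [isSuccSet_iff, exists_eq_right]
  constructor
  · rintro ⟨h1, h2, h3⟩
    ext x
    rw [mem_omega_iff]
    constructor
    · intro hx
      induction x using ZFSet.inductionOn with
      | _ x ih =>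
      rcases h3 x hx with rfl | ⟨k, hk, rfl⟩
      · exact ⟨0, rfl⟩
      · obtain ⟨n, rfl⟩ := ih k (mem_insert _ _) hk
        exact ⟨n + 1, rfl⟩
    · rintro ⟨n, rfl⟩
      induction n with
      | zero => exact h1
      | succ n ih => exact h2 _ ih
  · rintro rfl
    refine ⟨omega_zero, fun n hn => omega_succ hn, fun n hn => ?_⟩
    obtain ⟨k, rfl⟩ := mem_omega_iff.1 hn
    cases k with
    | zero => exact .inl rfl
    | succ k => exact .inr ⟨natZ k, mem_omega_iff.2 ⟨k, rfl⟩, rfl⟩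

section Dfn

variable {𝒮 : Set (Set ZFSet.{0})} {n : ℕ} {f g : (Fin n → ZFSet.{0}) → ZFSet.{0}}

theorem Dfn.isSuccSet (hf : IsProj f) (hg : IsProj g) :
    Dfn 𝒮 (fun v => IsSuccSet (f v) (g v)) := by
  obtain ⟨i, rfl⟩ := hf
  obtain ⟨j, rfl⟩ := hg
  unfold IsSuccSet
  exact .and (.mem (.coord _) (.coord _)) (.and (.subset (.coord _) (.coord _))
    (.ball (.coord _) (.or (.eq (.coord _) (.coord _)) (.mem (.coord _) (.coord _)))))

theorem Dfn.eqOmega (hf : IsProj f) : Dfn 𝒮 (fun v => f v = omega) := by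
  obtain ⟨i, rfl⟩ := hf
  simp only [← isOmega_iff]
  unfold IsOmega
  exact .and (.bex (.coord _) (.eqEmpty (.coord _)))
    (.and (.ball (.coord _) (.bex (.coord _) (.isSuccSet (.coord _) (.coord _))))
      (.ball (.coord _) (.or (.eqEmpty (.coord _))
        (.bex (.coord _) (.isSuccSet (.coord _) (.coord _))))))

end Dfn

theorem omega_countable : omega.{0}.toSet.Countable :=
  (mem_aleph_one_iff.1 omega_mem_aleph_one).2

theorem mem_Hset_of_mem_aleph_one (hκ : Aleph 1 ∈ κ) {α : ZFSet.{0}} (hα : α ∈ Aleph 1) :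
    α ∈ Hset κ := transCl_Hset κ _ (aleph_one_mem_Hset hκ) _ hα

/-! ### Countable elementary submodels of `H_κ` -/

variable {X : ZFSet.{0}}

theorem ElemSub.omega_mem (hX : ElemSub X (Hset κ)) (hκ : Aleph 1 ∈ κ) : omega ∈ X := by
  obtain ⟨w, hw, rfl⟩ := hX.exists_mem (transCl_Hset κ) (P := fun x (_ : Fin 0 → ZFSet.{0}) =>
    x = omega) (v := ![]) (.eqOmega (.coord 0)) (fun i => i.elim0)
    ⟨omega, mem_Hset_of_mem_aleph_one hκ omega_mem_aleph_one, rfl⟩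
  exact hw

theorem ElemSub.natZ_mem (hX : ElemSub X (Hset κ)) (hκ : Aleph 1 ∈ κ) (n : ℕ) : natZ n ∈ X := by
  have hω : ∀ n, natZ n ∈ Hset κ := fun n => transCl_Hset κ _
    (mem_Hset_of_mem_aleph_one hκ omega_mem_aleph_one) _ (mem_omega_iff.2 ⟨n, rfl⟩)
  induction n with
  | zero =>
    obtain ⟨w, hw, rfl⟩ := hX.exists_mem (transCl_Hset κ) (P := fun x (_ : Fin 0 → ZFSet.{0}) =>
      x = ∅) (v := ![]) (.eqEmpty (.coord 0)) (fun i => i.elim0) ⟨∅, hω 0, rfl⟩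
    exact hw
  | succ n ih =>
    obtain ⟨w, hw, h⟩ := hX.exists_mem (transCl_Hset κ) (P := fun x (v : Fin 1 → ZFSet.{0}) =>
      IsSuccSet (v 0) x) (v := ![natZ n]) (.isSuccSet (.coord _) (.coord 0))
      (Fin.cases ih fun i => i.elim0) ⟨natZ (n + 1), hω _, isSuccSet_iff.2 rfl⟩
    obtain rfl : w = natZ (n + 1) := isSuccSet_iff.1 h
    exact hw

/-- `e` is a relation assigning distinct nonempty subsets of `w` to the members of `α`. -/
def Enumerates (e α w : ZFSet.{0}) : Prop :=
  (∀ x ∈ α, ∃ n ∈ w, pair n x ∈ e) ∧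
    ∀ n ∈ w, ∀ x ∈ α, ∀ y ∈ α, pair n x ∈ e → pair n y ∈ e → x = y

theorem exists_enumerates {α : ZFSet.{0}} (hα : α.toSet.Countable) :
    ∃ e ⊆ prod (omega ∪ α) (omega ∪ α), Enumerates e α omega := by
  obtain ⟨g, hg⟩ := Set.countable_iff_exists_injOn.1 hα
  refine ⟨ZFSet.sep (fun p => ∃ x ∈ α, p = pair (natZ (g x)) x) (prod (omega ∪ α) (omega ∪ α)),
    ZFSet.sep_subset, ?_, ?_⟩
  · intro x hx
    have h : natZ (g x) ∈ omega := mem_omega_iff.2 ⟨_, rfl⟩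
    exact ⟨_, h, mem_sep.2 ⟨pair_mem_prod.2 ⟨mem_union.2 (.inl h), mem_union.2 (.inr hx)⟩,
      x, hx, rfl⟩⟩
  · intro n _ x hx y hy h1 h2
    obtain ⟨x', -, h1⟩ := (mem_sep.1 h1).2
    obtain ⟨y', -, h2⟩ := (mem_sep.1 h2).2
    obtain ⟨rfl, rfl⟩ := pair_inj.1 h1
    obtain ⟨h3, rfl⟩ := pair_inj.1 h2
    rw [natZ_eq_toZFSet, natZ_eq_toZFSet, Ordinal.toZFSet_injective.eq_iff, Nat.cast_inj] at h3
    exact hg hx hy h3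

/-- A submodel of `H_κ` contains every element of each of its countable ordinals. -/
theorem ElemSub.subset_of_mem_aleph_one (hX : ElemSub X (Hset κ)) (hκ : Aleph 1 ∈ κ)
    {α : ZFSet.{0}} (hα : α ∈ Aleph 1) (hαX : α ∈ X) : α ⊆ X := by
  have hω := hX.omega_mem hκ
  obtain ⟨hαo, hαc⟩ := mem_aleph_one_iff.1 hα
  obtain ⟨e, he, hE⟩ := exists_enumerates hαc
  have heH : e ∈ Hset κ := by
    refine mem_Hset_of_subset_prod hκ
      ((mem_aleph_one_iff.1 omega_mem_aleph_one).1.1.union hαo.1) ?_ he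
    refine (omega_countable.union hαc).mono fun x hx => ?_
    exact mem_union.1 hx
  obtain ⟨e, he, hE⟩ := hX.exists_mem (transCl_Hset κ) (P := fun e (v : Fin 2 → ZFSet.{0}) =>
    Enumerates e (v 0) (v 1)) (v := ![α, omega])
    (.and (.ball (.coord _) (.bex (.coord _) (.pairMem (.coord _) (.coord _) (.coord _))))
      (.ball (.coord _) (.ball (.coord _) (.ball (.coord _)
        (.imp (.pairMem (.coord _) (.coord _) (.coord _))
          (.imp (.pairMem (.coord _) (.coord _) (.coord _)) (.eq (.coord _) (.coord _))))))))
    (Fin.cases hαX (Fin.cases hω fun i => i.elim0)) ⟨e, heH, hE⟩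
  intro x hx
  obtain ⟨n, hn, hnx⟩ := hE.1 x hx
  obtain ⟨k, rfl⟩ := mem_omega_iff.1 hn
  obtain ⟨y, hy, hyα, hny⟩ := hX.exists_mem (transCl_Hset κ)
    (P := fun y (v : Fin 3 → ZFSet.{0}) => y ∈ v 2 ∧ pair (v 0) y ∈ v 1) (v := ![natZ k, e, α])
    (.and (.mem (.coord _) (.coord _)) (.pairMem (.coord _) (.coord _) (.coord _)))
    (Fin.cases (hX.natZ_mem hκ k) (Fin.cases he (Fin.cases hαX fun i => i.elim0)))
    ⟨x, transCl_Hset κ _ (mem_Hset_of_mem_aleph_one hκ hα) _ hx, hx, hnx⟩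
  exact hE.2 _ hn x hx y hyα hnx hny ▸ hy

/-- The image of `ω₁` under the collapse of `X` is `X ∩ ω₁`. -/
theorem ElemSub.mem_collapse_aleph_one (hX : ElemSub X (Hset κ)) (hκ : Aleph 1 ∈ κ)
    {z : ZFSet.{0}} : z ∈ collapse X (Aleph 1) ↔ z ∈ Aleph 1 ∧ z ∈ X := by
  have key : ∀ z ∈ Aleph 1, z ∈ X → collapse X z = z := by
    intro z hz hzX
    have hzo := (isOrd_aleph_one.mem hz)
    refine collapse_eq_self hzo.succ.1 (fun y hy => ?_) (mem_insert _ _)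
    rcases mem_insert_iff.1 hy with rfl | hy
    · exact hzX
    · exact hX.subset_of_mem_aleph_one hκ hz hzX hy
  rw [mem_collapse]
  constructor
  · rintro ⟨y, hy, hyX, rfl⟩
    rw [key y hy hyX]
    exact ⟨hy, hyX⟩
  · rintro ⟨hz, hzX⟩
    exact ⟨z, hz, hzX, key z hz hzX⟩

theorem ElemSub.collapse_aleph_one_mem (hX : ElemSub X (Hset κ)) (hκ : Aleph 1 ∈ κ)
    (hc : X.toSet.Countable) : collapse X (Aleph 1) ∈ Aleph 1 := by
  rw [mem_aleph_one_iff]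
  refine ⟨⟨fun x hx y hy => ?_, fun x hx => ?_⟩, hc.mono fun x hx => ?_⟩
  · rw [hX.mem_collapse_aleph_one hκ] at hx ⊢
    exact ⟨isOrd_aleph_one.1 x hx.1 hy, hX.subset_of_mem_aleph_one hκ hx.1 hx.2 hy⟩
  · exact isOrd_aleph_one.2 x ((hX.mem_collapse_aleph_one hκ).1 hx).1
  · exact ((hX.mem_collapse_aleph_one hκ).1 hx).2

/-! ### Countable `L`-cardinals -/

/-- `γ` is not a cardinal of `L`, as witnessed by sets in `S`. -/
def LCollapsedIn (S : Set ZFSet.{0}) (γ : ZFSet.{0}) : Prop :=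
  ∃ α ∈ γ, ∃ f ∈ S, ∃ H ∈ S, ∃ V ∈ S, LW f H V ∧ IsSurjF α γ f

theorem Dfn.lCollapsedIn {S : Set ZFSet.{0}} {n : ℕ} {f : (Fin n → ZFSet.{0}) → ZFSet.{0}}
    (hf : IsProj f) : Dfn {S} (fun v => LCollapsedIn S (f v)) := by
  obtain ⟨i, rfl⟩ := hf
  exact .bex (.coord _) (.ex (.ex (.ex (.and (.lW (.coord _) (.coord _) (.coord _))
    (.isSurjF (.coord _) (.coord _) (.coord _))))))

theorem lCard_iff_not_lCollapsedIn (hκ : Aleph 1 ∈ κ) {γ : ZFSet.{0}} (hγ : γ ∈ Aleph 1) :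
    LCard γ ↔ ¬ LCollapsedIn (Hset κ) γ := by
  obtain ⟨hγo, hγc⟩ := mem_aleph_one_iff.1 hγ
  constructor
  · rintro ⟨-, h⟩ ⟨α, hα, f, -, H, -, V, -, hL, hs⟩
    exact h α hα f hL.mem_LClass hs
  · refine fun h => ⟨hγo, fun α hα f hf hs => h ?_⟩
    have hsub : f ⊆ prod γ γ := fun p hp => by
      obtain ⟨a, ha, b, hb, rfl⟩ := mem_prod.1 (hs.1.1 hp)
      exact pair_mem_prod.2 ⟨hγo.1 α hα ha, hb⟩
    obtain ⟨A, hA, hAc, hfA⟩ := exists_transitive_of_subset_prod hγo.1 hγc hsub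
    obtain ⟨N, H, V, hN, hNc, hfN, hHN, hVN, hL⟩ := exists_countable_LW hf hA hAc hfA
    have hsubN := subset_Hset_of_countable hκ hN hNc
    exact ⟨α, hα, f, hsubN hfN, H, hsubN hHN, V, hsubN hVN, hL, hs⟩

end Hset

/-! ### Restricting the range of a constructible surjection -/

theorem doubleton_mem_Lstage {η a b : ZFSet.{0}} (hη : IsOrd η) (ha : a ∈ Lstage η)
    (hb : b ∈ Lstage η) : {a, b} ∈ Lstage (insert η η) := by
  refine mem_Lstage.2 ⟨η, mem_insert _ _, ?_⟩
  have h := sep_mem_defSet (Lstage_isTransitive hη)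
    (Q := fun v : Fin 3 → ZFSet.{0} => v 0 = v 1 ∨ v 0 = v 2)
    (.or (.eq (.coord _) (.coord _)) (.eq (.coord _) (.coord _))) ![a, b]
    (Fin.cases ha (Fin.cases hb fun i => i.elim0))
  convert h using 1
  ext z
  rw [mem_sep, mem_pair]
  refine ⟨fun h => ⟨?_, h⟩, fun h => h.2⟩
  rcases h with rfl | rfl <;> assumption

theorem pair_mem_Lstage {η a b : ZFSet.{0}} (hη : IsOrd η) (ha : a ∈ Lstage η)
    (hb : b ∈ Lstage η) : pair a b ∈ Lstage (insert (insert η η) (insert η η)) := by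
  have h : pair a b = {({a, a} : ZFSet.{0}), {a, b}} := by simp [pair]
  rw [h]
  exact doubleton_mem_Lstage hη.succ (doubleton_mem_Lstage hη ha ha)
    (doubleton_mem_Lstage hη ha hb)

theorem exists_isSurjF_of_mem {α γ δ f : ZFSet.{0}} (hδ : IsOrd δ) (hγ : γ ∈ δ) (hα : α ∈ γ)
    (hf : f ∈ LClass) (hs : IsSurjF α δ f) : ∃ g ∈ LClass, IsSurjF α γ g := by
  obtain ⟨η, hη, hfη⟩ := hf
  set M := Lstage η with hM
  set N := Lstage (insert (insert η η) (insert η η)) with hN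
  have hηη : IsOrd (insert (insert η η) (insert η η)) := hη.succ.succ
  have hMT : M.IsTransitive := Lstage_isTransitive hη
  have hMN : M ⊆ N := Lstage_mono fun x hx => mem_insert_of_mem _ (mem_insert_of_mem _ hx)
  have hγδ : γ ⊆ δ := hδ.1 γ hγ
  have hδM : δ ⊆ M := fun y hy => by
    obtain ⟨x, hx, hxy⟩ := hs.2 y hy
    have h1 : ({x, y} : ZFSet.{0}) ∈ pair x y := by simp [pair]
    exact hMT _ (hMT _ (hMT _ hfη hxy) h1) (by simp)
  have hαM : α ⊆ M := hMT _ (hδM (hγδ hα))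
  rw [isSurjF_iff] at hs
  obtain ⟨hs1, hs2, hs3⟩ := hs
  let R : ZFSet.{0} → ZFSet.{0} → Prop := fun x y =>
    pair x y ∈ f ∨ (y = α ∧ ∀ y' ∈ γ, pair x y' ∉ f)
  have h := sep_mem_defSet (Lstage_isTransitive hηη) (Q := fun v : Fin 4 → ZFSet.{0} =>
      ∃ x ∈ v 2, ∃ y ∈ v 3, v 0 = pair x y ∧
        (pair x y ∈ v 1 ∨ (y = v 2 ∧ ∀ y' ∈ v 3, pair x y' ∉ v 1)))
    (.bex (.coord _) (.bex (.coord _) (.and (.pair (.coord _) (.coord _) (.coord _))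
      (.or (.pairMem (.coord _) (.coord _) (.coord _)) (.and (.eq (.coord _) (.coord _))
        (.ball (.coord _) (.not (.pairMem (.coord _) (.coord _) (.coord _)))))))))
    ![f, α, γ] (Fin.cases (hMN hfη) (Fin.cases (hMN (hδM (hγδ hα)))
      (Fin.cases (hMN (hδM hγ)) fun i => i.elim0)))
  obtain ⟨g, hg, hgR⟩ : ∃ g ∈ LClass, ∀ z, z ∈ g ↔ ∃ x ∈ α, ∃ y ∈ γ, z = pair x y ∧ R x y := by
    refine ⟨_, ⟨_, hηη.succ, mem_Lstage.2 ⟨_, mem_insert _ _, h⟩⟩, fun z => ?_⟩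
    rw [mem_sep]
    refine ⟨fun h => h.2, fun h => ⟨?_, h⟩⟩
    obtain ⟨x, hx, y, hy, rfl, -⟩ := h
    exact pair_mem_Lstage hη (hαM hx) (hδM (hγδ hy))
  have hgp : ∀ x ∈ α, ∀ y ∈ γ, (pair x y ∈ g ↔ R x y) := by
    intro x hx y hy
    rw [hgR]
    constructor
    · rintro ⟨x', -, y', -, he, h⟩
      obtain ⟨rfl, rfl⟩ := pair_inj.1 he
      exact h
    · exact fun h => ⟨x, hx, y, hy, rfl, h⟩
  refine ⟨g, hg, isSurjF_iff.2 ⟨fun p hp => ?_, fun x hx => ?_, fun y hy => ?_⟩⟩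
  · obtain ⟨x, hx, y, hy, rfl, -⟩ := (hgR p).1 hp
    exact ⟨x, hx, y, hy, rfl⟩
  · obtain ⟨y, hy, hxy, hu⟩ := hs2 x hx
    by_cases hyγ : y ∈ γ
    · refine ⟨y, hyγ, (hgp x hx y hyγ).2 (.inl hxy), fun y' hy' h => ?_⟩
      rcases (hgp x hx y' hy').1 h with h | h
      · exact hu y' (hγδ hy') h
      · exact absurd hxy (h.2 y hyγ)
    · have hno : ∀ y' ∈ γ, pair x y' ∉ f := fun y' hy' h =>
        hyγ (hu y' (hγδ hy') h ▸ hy')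
      refine ⟨α, hα, (hgp x hx α hα).2 (.inr ⟨rfl, hno⟩), fun y' hy' h => ?_⟩
      rcases (hgp x hx y' hy').1 h with h | h
      · exact absurd h (hno y' hy')
      · exact h.1
  · obtain ⟨x, hx, hxy⟩ := hs3 y (hγδ hy)
    exact ⟨x, hx, (hgp x hx y hy).2 (.inl hxy)⟩

theorem lCard_aleph_one : LCard (Aleph 1) := by
  refine ⟨isOrd_aleph_one, fun α hα f _ hs => not_countable_aleph_one ?_⟩
  choose! g hg using hs.2
  have hinj : Set.InjOn g (Aleph 1).toSet := by
    intro y hy y' hy' he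
    refine (hs.1.2 (g y) (hg y hy).1).unique (hg y hy).2 ?_
    rw [he]
    exact (hg y' hy').2
  exact Set.MapsTo.countable_of_injOn (fun y hy => (hg y hy).1) hinj (mem_aleph_one_iff.1 hα).2

/-! ### The equivalence -/

theorem sRPL_of_unbounded
    (h : ∀ β, β ∈ Aleph 1 → ∃ δ, δ ∈ Aleph 1 ∧ β ∈ δ ∧ LCard δ) : SRPL (Aleph 1) := by
  obtain ⟨κ, hκr, hκ⟩ := exists_isRegular
  refine ⟨κ, hκr, hκ, fun X hX hXc hωX => ?_⟩
  have hδ := hX.collapse_aleph_one_mem hκ hXc.1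
  have hmem := fun z => hX.mem_collapse_aleph_one hκ (z := z)
  set δ := collapse X (Aleph 1)
  have hδo := (mem_aleph_one_iff.1 hδ).1
  refine ⟨hδo, fun α hα f hf hs => ?_⟩
  obtain ⟨hα1, hαX⟩ := (hmem α).1 hα
  obtain ⟨γ, hγ1, hαγ, hγ⟩ := h α hα1
  obtain ⟨γ, hγX, hγ1, hαγ, hγ⟩ := hX.exists_mem (transCl_Hset κ)
    (P := fun γ (v : Fin 2 → ZFSet.{0}) => γ ∈ v 0 ∧ v 1 ∈ γ ∧ ¬ LCollapsedIn (Hset κ) γ)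
    (v := ![Aleph 1, α])
    (.and (.mem (.coord _) (.coord _)) (.and (.mem (.coord _) (.coord _))
      (.not (.lCollapsedIn (.coord 0)))))
    (Fin.cases hωX (Fin.cases hαX fun i => i.elim0))
    ⟨γ, mem_Hset_of_mem_aleph_one hκ hγ1, hγ1, hαγ, (lCard_iff_not_lCollapsedIn hκ hγ1).1 hγ⟩
  obtain ⟨g, hg, hgs⟩ := exists_isSurjF_of_mem hδo ((hmem γ).2 ⟨hγ1, hγX⟩) hαγ hf hs
  exact ((lCard_iff_not_lCollapsedIn hκ hγ1).2 hγ).2 α hαγ g hg hgs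

theorem wRPL_of_sRPL (h : SRPL (Aleph 1)) : WRPL (Aleph 1) := by
  obtain ⟨κ, hκr, hκ, h⟩ := h
  have hω : omega.toSet ⊆ Hset κ := subset_Hset_of_countable hκ
    (mem_aleph_one_iff.1 omega_mem_aleph_one).1.1 omega_countable
  obtain ⟨X, hAX, hXc, hX⟩ := exists_elemSub (omega_countable.insert (Aleph 1))
    (Set.insert_subset (aleph_one_mem_Hset hκ) hω) ⟨_, aleph_one_mem_Hset hκ⟩
  have hinf : CtblInf X := by
    refine ⟨hXc, Set.Infinite.mono (fun x hx => hAX (.inr hx)) (s := omega.toSet) ?_⟩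
    refine Set.infinite_of_injective_forall_mem (f := natZ) (fun m n h => ?_)
      fun n => mem_omega_iff.2 ⟨n, rfl⟩
    rwa [natZ_eq_toZFSet, natZ_eq_toZFSet, Ordinal.toZFSet_injective.eq_iff, Nat.cast_inj] at h
  exact ⟨κ, hκr, hκ, X, hX, hinf, hAX (.inl rfl), h X hX hinf (hAX (.inl rfl))⟩

theorem unbounded_of_wRPL (h : WRPL (Aleph 1)) :
    ∀ β, β ∈ Aleph 1 → ∃ δ, δ ∈ Aleph 1 ∧ β ∈ δ ∧ LCard δ := by
  obtain ⟨κ, hκr, hκ, X, hX, hXc, hωX, hL⟩ := h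
  have hδ := hX.collapse_aleph_one_mem hκ hXc.1
  by_contra! hno
  obtain ⟨β, hβ, hno⟩ := hno
  obtain ⟨β, hβX, hβ, hno⟩ := hX.exists_mem (transCl_Hset κ)
    (P := fun β (v : Fin 1 → ZFSet.{0}) => β ∈ v 0 ∧ ∀ δ ∈ v 0, β ∈ δ → LCollapsedIn (Hset κ) δ)
    (v := ![Aleph 1])
    (.and (.mem (.coord _) (.coord _)) (.ball (.coord _) (.imp (.mem (.coord _) (.coord _))
      (.lCollapsedIn (.coord 0)))))
    (Fin.cases hωX fun i => i.elim0)
    ⟨β, mem_Hset_of_mem_aleph_one hκ hβ, hβ, fun δ hδ hβδ => by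
      by_contra hc
      exact hno δ hδ hβδ ((lCard_iff_not_lCollapsedIn hκ hδ).2 hc)⟩
  exact (lCard_iff_not_lCollapsedIn hκ hδ).1 hL
    (hno _ hδ ((hX.mem_collapse_aleph_one hκ).2 ⟨hβ, hβX⟩))

/-! ## The statement -/

/-- Proposition 2.10: `ω₁` is a limit cardinal in `L` iff `WRP^L(ω₁)` iff
`SRP^L(ω₁)`. -/
theorem statement3 :
    List.TFAE
      [LCard (Aleph 1) ∧ ∀ β, β ∈ Aleph 1 → ∃ δ, δ ∈ Aleph 1 ∧ β ∈ δ ∧ LCard δ,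
       WRPL (Aleph 1),
       SRPL (Aleph 1)] := by
  tfae_have 1 → 3 := fun h => sRPL_of_unbounded h.2
  tfae_have 3 → 2 := wRPL_of_sRPL
  tfae_have 2 → 1 := fun h => ⟨lCard_aleph_one, unbounded_of_wRPL h⟩
  tfae_finish

end SRPPaper
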